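/- Assume in addition that K is a finite extension of ℚ_p with d = [K:ℚ_p] and with exactly q p-power roots of unity, where q ≥ 3 (this forces d to be even), that L contains at least q p-power roots of unity (so μ_q(L) := {ζ ∈ L : ζ^q = 1} has exactly q elements), that n ≥ 2, and that p > n. Let δ̄ ∈ R[1/p] denote the image of det(I + X_1). Then the natural ring homomorphism R[1/p] → ∏_{ζ ∈ μ_q(L)} R[1/p]/(δ̄ − ζ) is an isomorphism, and each factor R[1/p]/(δ̄ − ζ) is a nonzero integral domain. Consequently R[1/p] has exactly q minimal primes, and Spec R[1/p] has exactly q connected components, each of which is irreducible, indexed by μ_q(L). -/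

import Mathlib

set_option synthInstance.maxHeartbeats 1000000
set_option maxHeartbeats 1000000

noncomputable section

/-- The ring of integers of `L`: the integral closure of `ℤ_[p]` in `L`. -/
abbrev RingOfIntegers (p : ℕ) [Fact p.Prime] (L : Type*) [Field L] [Algebra ℤ_[p] L] :=
  integralClosure ℤ_[p] L

/-- A `q`-th root of unity of `L` is integral over `ℤ_[p]`, hence lies in `𝒪_L`. -/
def rootOfUnityToO (p : ℕ) [Fact p.Prime] (L : Type*) [Field L] [Algebra ℤ_[p] L]
    (q : ℕ) (hq : q ≠ 0) (ζ : {z : L // z ^ q = 1}) : RingOfIntegers p L :=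
  ⟨ζ.1, show IsIntegral ℤ_[p] ζ.1 from
    ⟨Polynomial.X ^ q - Polynomial.C 1,
      Polynomial.monic_X_pow_sub_C 1 hq, by
        have h := ζ.2
        simp [Polynomial.eval₂_sub, Polynomial.eval₂_pow, h]⟩⟩

/-- The matrix of variables `X_k` inside the multivariate power series ring. -/
def varMatrix {A : Type*} [CommRing A] (N n : ℕ) (k : Fin N) :
    Matrix (Fin n) (Fin n) (MvPowerSeries (Fin N × Fin n × Fin n) A) :=
  Matrix.of fun i j => MvPowerSeries.X (k, i, j)

/-- `X̃_k = I + X_k`. -/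
def Xt {A : Type*} [CommRing A] (N n : ℕ) (k : Fin N) :
    Matrix (Fin n) (Fin n) (MvPowerSeries (Fin N × Fin n × Fin n) A) :=
  1 + varMatrix N n k

/-- Commutator `[A, B] = A B A⁻¹ B⁻¹` of square matrices. -/
def matComm {R : Type*} [CommRing R] {n : ℕ} (A B : Matrix (Fin n) (Fin n) R) :
    Matrix (Fin n) (Fin n) R :=
  A * B * A⁻¹ * B⁻¹

/-- The Demuškin relation matrix
`X̃_1^q ⬝ [X̃_1, X̃_2] ⬝ [X̃_3, X̃_4] ⋯ [X̃_{d+1}, X̃_{d+2}]` with `d = 2m`. -/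
def relMatrix {A : Type*} [CommRing A] (q m n : ℕ) :
    Matrix (Fin n) (Fin n) (MvPowerSeries (Fin (2 * m + 2) × Fin n × Fin n) A) :=
  (Xt (2 * m + 2) n ⟨0, by omega⟩) ^ q *
    (List.ofFn (fun i : Fin (m + 1) =>
      matComm (Xt (2 * m + 2) n ⟨2 * i, by have := i.isLt; omega⟩)
        (Xt (2 * m + 2) n ⟨2 * i + 1, by have := i.isLt; omega⟩))).prod

/-- The ideal generated by the `n²` entries of the relation matrix minus the identity. -/
def relIdeal {A : Type*} [CommRing A] (q m n : ℕ) :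
    Ideal (MvPowerSeries (Fin (2 * m + 2) × Fin n × Fin n) A) :=
  Ideal.span (Set.range fun ij : Fin n × Fin n =>
    (relMatrix (A := A) q m n - 1) ij.1 ij.2)

/-- The universal framed deformation ring `R = S / I_rel`. -/
abbrev defRing {A : Type*} [CommRing A] (q m n : ℕ) :=
  MvPowerSeries (Fin (2 * m + 2) × Fin n × Fin n) A ⧸ relIdeal (A := A) q m n

/-- The scheme-theoretic generic fiber `R[1/p]` of the framed deformation space. -/
def genericFiberRing (p : ℕ) (A : Type*) [CommRing A] (q m n : ℕ) : Type _ :=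
  Localization.Away (p : defRing (A := A) q m n)

instance (p : ℕ) (A : Type*) [CommRing A] (q m n : ℕ) :
    CommRing (genericFiberRing p A q m n) :=
  inferInstanceAs (CommRing (Localization _))

instance (p : ℕ) (A : Type*) [CommRing A] (q m n : ℕ) :
    Algebra (defRing (A := A) q m n) (genericFiberRing p A q m n) :=
  inferInstanceAs (Algebra _ (Localization _))

/-- The image `δ̄` of `det(I + X_1)` in `R[1/p]`. -/
def deltaBar (p : ℕ) (A : Type*) [CommRing A] (q m n : ℕ) : genericFiberRing p A q m n :=
  algebraMap (defRing (A := A) q m n) (genericFiberRing p A q m n)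
    (Ideal.Quotient.mk (relIdeal (A := A) q m n)
      (Matrix.det (Xt (A := A) (2 * m + 2) n ⟨0, by omega⟩)))

/-- The natural map `𝒪_L → R → R[1/p]`. -/
def toGenericFiber (p : ℕ) (A : Type*) [CommRing A] (q m n : ℕ) :
    A →+* genericFiberRing p A q m n :=
  (algebraMap (defRing (A := A) q m n) (genericFiberRing p A q m n)).comp
    (algebraMap A (defRing (A := A) q m n))

/-- The ideal `(δ̄ - ζ)` of `R[1/p]`. -/
def componentIdeal (p : ℕ) (A : Type*) [CommRing A] (q m n : ℕ) (z : A) :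
    Ideal (genericFiberRing p A q m n) :=
  Ideal.span {deltaBar p A q m n - toGenericFiber p A q m n z}

/-- A list of ring elements, read from right to left, each of which is not in the ideal generated
by its predecessors and all of whose initial parts generate prime ideals. -/
def PrimeChain {R : Type*} [CommRing R] : List R → Prop
  | [] => (⊥ : Ideal R).IsPrime
  | f :: l => PrimeChain l ∧ f ∉ Ideal.ofList l ∧ (Ideal.ofList (f :: l)).IsPrime

theorem PrimeChain.isPrime {R : Type*} [CommRing R] {l : List R} (h : PrimeChain l) :
    (Ideal.ofList l).IsPrime := by
  cases l with
  | nil => rw [Ideal.ofList_nil]; exact h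
  | cons f l => exact h.2.2

/-- An abstract calculus of leading terms: `rel N a g` says that `a` has filtration degree at
least `N` and that `g` is its component of degree `N`. -/
structure SymbolCalculus (S G : Type*) [CommRing S] [CommRing G] where
  rel : ℕ → S → G → Prop
  exists_zero : ∀ a, ∃ g, rel 0 a g
  one : rel 0 1 1
  unique : ∀ {N a g g'}, rel N a g → rel N a g' → g = g'
  sub : ∀ {N a b g h}, rel N a g → rel N b h → rel N (a - b) (g - h)
  mul : ∀ {M N a b g h}, rel M a g → rel N b h → rel (M + N) (a * b) (g * h)
  succ_of_zero : ∀ {N a}, rel N a 0 → ∃ g, rel (N + 1) a g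
  of_succ : ∀ {N a g}, rel (N + 1) a g → rel N a 0

namespace SymbolCalculus

variable {S G : Type*} [CommRing S] [CommRing G] (C : SymbolCalculus S G)

theorem zero_of_lt {M N : ℕ} {a : S} {g : G} (h : C.rel N a g) (hMN : M < N) : C.rel M a 0 := by
  induction N generalizing g with
  | zero => omega
  | succ N ih =>
    rcases Nat.lt_succ_iff_lt_or_eq.1 hMN with h1 | rfl
    · exact ih (C.of_succ h) h1
    · exact C.of_succ h

variable {ι : Type*} (f : ι → S) (F : ι → G) (d : ι → ℕ)

/-- Leading terms of members of the ideal generated by a list lie in the ideal generated by the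
leading terms of the list, if these form a prime chain. -/
theorem mem_of_rel (hfF : ∀ x, C.rel (d x) (f x) (F x))
    (hlift : ∀ (L : List ι) (M : ℕ) (a : S) (g : G), C.rel M a g → g ∈ Ideal.ofList (L.map F) →
      ∃ b ∈ Ideal.ofList (L.map f), C.rel M b g)
    (L : List ι) (hL : PrimeChain (L.map F)) {N : ℕ} {g : S} {γ : G}
    (hg : g ∈ Ideal.ofList (L.map f)) (hr : C.rel N g γ) : γ ∈ Ideal.ofList (L.map F) := by
  induction L generalizing N g γ with
  | nil =>
    simp only [List.map_nil, Ideal.ofList_nil, Ideal.mem_bot] at hg ⊢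
    subst hg
    have h0 := C.sub hr hr
    rw [sub_self, sub_self] at h0
    exact C.unique hr h0
  | cons x L ih =>
    obtain ⟨hL1, hL2, -⟩ := hL
    have hP := hL1.isPrime
    replace ih := @ih hL1
    simp only [List.map_cons, Ideal.ofList_cons] at hg ⊢
    have key : ∀ M, M = 0 ∨ M + d x ≤ N → ∃ h g' η, g' ∈ Ideal.ofList (L.map f) ∧
        g - h * f x = g' ∧ C.rel M h η := by
      intro M
      induction M with
      | zero =>
        intro _
        obtain ⟨u, hu, v, hv, huv⟩ := Submodule.mem_sup.1 hg
        obtain ⟨h, rfl⟩ := Ideal.mem_span_singleton'.1 hu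
        obtain ⟨η, hη⟩ := C.exists_zero h
        exact ⟨h, v, η, hv, by rw [← huv]; ring, hη⟩
      | succ M ihM =>
        intro hM
        replace hM : M + 1 + d x ≤ N := by omega
        obtain ⟨h, g', η, hg', hgg', hη⟩ := ihM (by omega)
        have h1 := C.sub (C.zero_of_lt hr (show M + d x < N by omega)) (C.mul hη (hfF x))
        rw [hgg', zero_sub] at h1
        have h2 : η * F x ∈ Ideal.ofList (L.map F) := neg_mem_iff.1 (ih hg' h1)
        have h3 : η ∈ Ideal.ofList (L.map F) := (hP.mem_or_mem h2).resolve_right hL2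
        obtain ⟨b, hb, hbη⟩ := hlift L M h η hη h3
        have h4 := C.sub hη hbη
        rw [sub_self] at h4
        obtain ⟨η', hη'⟩ := C.succ_of_zero h4
        exact ⟨h - b, g' + b * f x, η', add_mem hg' (Ideal.mul_mem_right _ _ hb),
          by rw [← hgg']; ring, hη'⟩
    by_cases hd : d x ≤ N
    · obtain ⟨h, g', η, hg', hgg', hη⟩ := key (N - d x) (Or.inr (by omega))
      have h1 := C.mul hη (hfF x)
      rw [Nat.sub_add_cancel hd] at h1
      have h2 := C.sub hr h1
      rw [hgg'] at h2
      have h3 := ih hg' h2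
      rw [show γ = η * F x + (γ - η * F x) by ring]
      exact add_mem (Ideal.mem_sup_left (Ideal.mem_span_singleton'.2 ⟨η, rfl⟩))
        (Ideal.mem_sup_right h3)
    · obtain ⟨h, g', η, hg', hgg', hη⟩ := key 0 (Or.inl rfl)
      have h1 := C.mul hη (hfF x)
      have h2 := C.sub hr (C.zero_of_lt h1 (show N < 0 + d x by omega))
      rw [hgg', sub_zero] at h2
      exact Ideal.mem_sup_right (ih hg' h2)

theorem isPrime_of_isPrime (I : Ideal S) (J : Ideal G) [hJ : J.IsPrime]
    (hIJ : ∀ {N g γ}, g ∈ I → C.rel N g γ → γ ∈ J)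
    (hlift : ∀ (M : ℕ) (a : S) (g : G), C.rel M a g → g ∈ J → ∃ b ∈ I, C.rel M b g)
    (hclosed : ∀ a, (∀ N, ∃ b ∈ I, ∃ g, C.rel N (a - b) g) → a ∈ I) : I.IsPrime := by
  have red : ∀ a, a ∉ I → ∃ b ∈ I, ∃ N g, C.rel N (a - b) g ∧ g ∉ J := by
    intro a ha
    by_contra! hcon
    refine ha (hclosed a fun N => ?_)
    induction N with
    | zero => exact ⟨0, I.zero_mem, C.exists_zero _⟩
    | succ N ih =>
      obtain ⟨b, hb, g, hg⟩ := ih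
      obtain ⟨c, hc, hcg⟩ := hlift N _ g hg (hcon b hb N g hg)
      have h1 := C.sub hg hcg
      rw [sub_self] at h1
      obtain ⟨g', hg'⟩ := C.succ_of_zero h1
      exact ⟨b + c, add_mem hb hc, g', by rwa [← sub_sub]⟩
  refine ⟨fun h => ?_, fun {a b} hab => ?_⟩
  · exact hJ.ne_top (Ideal.eq_top_of_isUnit_mem _ (hIJ (h ▸ Submodule.mem_top) C.one) isUnit_one)
  · by_contra! hcon
    obtain ⟨a', ha', M, g, hg, hgJ⟩ := red a hcon.1
    obtain ⟨b', hb', N, h, hh, hhJ⟩ := red b hcon.2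
    have h1 : (a - a') * (b - b') ∈ I := by
      rw [show (a - a') * (b - b') = a * b - a * b' - a' * (b - b') by ring]
      exact sub_mem (sub_mem hab (Ideal.mul_mem_left _ _ hb')) (Ideal.mul_mem_right _ _ ha')
    exact (hJ.mem_or_mem (hIJ h1 (C.mul hg hh))).elim hgJ hhJ

/-- A list whose leading terms form a prime chain is itself a prime chain. -/
theorem primeChain (hfF : ∀ x, C.rel (d x) (f x) (F x))
    (hlift : ∀ (L : List ι) (M : ℕ) (a : S) (g : G), C.rel M a g → g ∈ Ideal.ofList (L.map F) →
      ∃ b ∈ Ideal.ofList (L.map f), C.rel M b g)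
    (hclosed : ∀ (L : List ι) a, (∀ N, ∃ b ∈ Ideal.ofList (L.map f), ∃ g, C.rel N (a - b) g) →
      a ∈ Ideal.ofList (L.map f))
    (L : List ι) (hL : PrimeChain (L.map F)) : PrimeChain (L.map f) := by
  have key : ∀ L : List ι, PrimeChain (L.map F) → (Ideal.ofList (L.map f)).IsPrime := fun L hL =>
    have := hL.isPrime
    C.isPrime_of_isPrime _ (Ideal.ofList (L.map F)) (C.mem_of_rel f F d hfF hlift L hL)
      (hlift L) (hclosed L)
  induction L with
  | nil =>
    have := key [] hL
    rwa [List.map_nil, Ideal.ofList_nil] at this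
  | cons x L ih =>
    exact ⟨ih hL.1, fun h => hL.2.1 (C.mem_of_rel f F d hfF hlift L hL.1 h (hfF x)),
      key (x :: L) hL⟩

end SymbolCalculus

/-- Ideals of a Noetherian local ring are closed. -/
theorem Ideal.mem_of_forall_exists_sub_mem_pow {S : Type*} [CommRing S] [IsNoetherianRing S]
    [IsLocalRing S] (I m : Ideal S) (hm : m ≠ ⊤) (a : S)
    (h : ∀ N, ∃ b ∈ I, a - b ∈ m ^ N) : a ∈ I := by
  have h1 := Ideal.iInf_pow_smul_eq_bot_of_isLocalRing (R := S) (M := S ⧸ I) m hm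
  rw [← Ideal.Quotient.eq_zero_iff_mem, ← Submodule.mem_bot (R := S), ← h1, Submodule.mem_iInf]
  intro N
  obtain ⟨b, hb, hab⟩ := h N
  have h2 : Ideal.Quotient.mk I a = (a - b) • (1 : S ⧸ I) := by
    rw [Algebra.smul_def, mul_one, Ideal.Quotient.algebraMap_eq, map_sub,
      Ideal.Quotient.eq_zero_iff_mem.2 hb, sub_zero]
  rw [h2]
  exact Submodule.smul_mem_smul hab Submodule.mem_top

theorem MvPowerSeries.exists_coeff_eq {σ R : Type*} [Semiring R] (c : (σ →₀ ℕ) → R) :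
    ∃ s : MvPowerSeries σ R, ∀ n, MvPowerSeries.coeff n s = c n :=
  ⟨c, fun _ => rfl⟩

section Uniformizer

variable {O : Type*} [CommRing O] [IsDomain O] [IsLocalRing O] {σ : Type*}

/-- Symbols of power series for the filtration by powers of a uniformizer of the
coefficient ring. -/
def uniformizerSymbols (ϖ : O) (hϖ : IsLocalRing.maximalIdeal O = Ideal.span {ϖ}) (h0 : ϖ ≠ 0) :
    SymbolCalculus (MvPowerSeries σ O) (MvPowerSeries σ (IsLocalRing.ResidueField O)) where
  rel N a g := ∃ s, a = MvPowerSeries.C ϖ ^ N * s ∧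
    MvPowerSeries.map (IsLocalRing.residue O) s = g
  exists_zero a := ⟨_, a, by simp, rfl⟩
  one := ⟨1, by simp, map_one _⟩
  unique := by
    rintro N a _ _ ⟨s, rfl, rfl⟩ ⟨s', h, rfl⟩
    rw [mul_left_cancel₀ (pow_ne_zero N ((map_ne_zero_iff _ MvPowerSeries.C_injective).2 h0)) h]
  sub := by
    rintro N _ _ _ _ ⟨s, rfl, rfl⟩ ⟨s', rfl, rfl⟩
    exact ⟨s - s', by ring, map_sub _ _ _⟩
  mul := by
    rintro M N _ _ _ _ ⟨s, rfl, rfl⟩ ⟨s', rfl, rfl⟩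
    exact ⟨s * s', by ring, map_mul _ _ _⟩
  succ_of_zero := by
    rintro N _ ⟨s, rfl, hs⟩
    have h1 : ∀ n, ∃ c, MvPowerSeries.coeff n s = ϖ * c := fun n => by
      have h2 := congrArg (MvPowerSeries.coeff n) hs
      rw [MvPowerSeries.coeff_map, map_zero, IsLocalRing.residue_eq_zero_iff, hϖ,
        Ideal.mem_span_singleton] at h2
      exact h2
    choose c hc using h1
    obtain ⟨t, ht⟩ := MvPowerSeries.exists_coeff_eq c
    refine ⟨_, t, ?_, rfl⟩
    rw [pow_succ, mul_assoc]
    congr 1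
    ext n
    rw [MvPowerSeries.coeff_C_mul, hc, ht]
  of_succ := by
    rintro N _ _ ⟨s, rfl, rfl⟩
    refine ⟨MvPowerSeries.C ϖ * s, by ring, ?_⟩
    have h1 : IsLocalRing.residue O ϖ = 0 := by
      rw [IsLocalRing.residue_eq_zero_iff, hϖ]
      exact Ideal.mem_span_singleton_self _
    rw [map_mul, MvPowerSeries.map_C, h1, map_zero, zero_mul]

/-- A list of power series that reduces to a prime chain is a prime chain. -/
theorem primeChain_of_map_residue [IsNoetherianRing O] [Finite σ] (ϖ : O)
    (hϖ : IsLocalRing.maximalIdeal O = Ideal.span {ϖ}) (h0 : ϖ ≠ 0)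
    (l : List (MvPowerSeries σ O))
    (hl : PrimeChain (l.map (MvPowerSeries.map (IsLocalRing.residue O)))) :
    PrimeChain l ∧ MvPowerSeries.C ϖ ∉ Ideal.ofList l := by
  let C := uniformizerSymbols (σ := σ) ϖ hϖ h0
  have hf : ∀ x : MvPowerSeries σ O,
      C.rel 0 (id x) (MvPowerSeries.map (IsLocalRing.residue O) x) :=
    fun x => ⟨x, by simp, rfl⟩
  have hsurj : Function.Surjective (MvPowerSeries.map (σ := σ) (IsLocalRing.residue O)) := by
    intro g
    choose c hc using fun n => IsLocalRing.residue_surjective (R := O) (MvPowerSeries.coeff n g)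
    obtain ⟨t, ht⟩ := MvPowerSeries.exists_coeff_eq c
    refine ⟨t, ?_⟩
    ext n
    rw [MvPowerSeries.coeff_map, ← hc, ht]
  have hlift : ∀ (L : List (MvPowerSeries σ O)) (M : ℕ) (a : MvPowerSeries σ O)
      (g : MvPowerSeries σ (IsLocalRing.ResidueField O)), C.rel M a g →
      g ∈ Ideal.ofList (L.map (MvPowerSeries.map (IsLocalRing.residue O))) →
      ∃ b ∈ Ideal.ofList (L.map id), C.rel M b g := by
    intro L M a g _ hg
    rw [← Ideal.map_ofList, Ideal.mem_map_iff_of_surjective _ hsurj] at hg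
    obtain ⟨x, hx, rfl⟩ := hg
    exact ⟨_, Ideal.mul_mem_left _ _ (by rwa [List.map_id]), x, rfl, rfl⟩
  have hclosed : ∀ (L : List (MvPowerSeries σ O)) a,
      (∀ N, ∃ b ∈ Ideal.ofList (L.map id), ∃ g, C.rel N (a - b) g) →
      a ∈ Ideal.ofList (L.map id) := by
    intro L a h
    refine Ideal.mem_of_forall_exists_sub_mem_pow _ (Ideal.span {MvPowerSeries.C ϖ}) ?_ _
      fun N => ?_
    · rw [Ne, Ideal.span_singleton_eq_top, MvPowerSeries.isUnit_iff_constantCoeff,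
        MvPowerSeries.constantCoeff_C, ← mem_nonunits_iff, ← IsLocalRing.mem_maximalIdeal, hϖ]
      exact Ideal.mem_span_singleton_self _
    · obtain ⟨b, hb, g, s, hs, -⟩ := h N
      refine ⟨b, hb, ?_⟩
      rw [hs, Ideal.span_singleton_pow]
      exact Ideal.mul_mem_right _ _ (Ideal.mem_span_singleton_self _)
  have key := C.primeChain id _ (fun _ => 0) hf hlift hclosed l hl
  rw [List.map_id] at key
  refine ⟨key, fun h => hl.isPrime.ne_top ?_⟩
  rw [Ideal.eq_top_iff_one]
  exact C.mem_of_rel id _ (fun _ => 0) hf hlift l hl (N := 1) (by rwa [List.map_id])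
    ⟨1, by simp, map_one _⟩

end Uniformizer

section Weighted

open MvPowerSeries in
theorem MvPowerSeries.mem_span_X_pow {σ R : Type*} [CommRing R] [Finite σ] (N : ℕ)
    (a : MvPowerSeries σ R) (h : ∀ α : σ →₀ ℕ, α.degree < N → coeff α a = 0) :
    a ∈ Ideal.span (Set.range (X : σ → MvPowerSeries σ R)) ^ N := by
  classical
  induction N generalizing a with
  | zero => simp
  | succ N ih =>
    cases nonempty_fintype σ
    have hex : ∀ α : σ →₀ ℕ, α = 0 ∨ ∃ i, α i ≠ 0 := fun α => by
      rw [or_iff_not_imp_left]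
      exact fun h0 => Finsupp.ne_iff.1 h0
    rcases isEmpty_or_nonempty σ with hσ | hσ
    · rw [show a = 0 from ?_]
      · exact zero_mem _
      · ext α
        rw [map_zero]
        refine h α ?_
        rw [Subsingleton.elim α 0, map_zero]
        omega
    have hex' : ∀ α : σ →₀ ℕ, ∃ i, α ≠ 0 → α i ≠ 0 := fun α => by
      rcases hex α with h0 | ⟨i, hi⟩
      · exact ⟨hσ.some, fun h => absurd h0 h⟩
      · exact ⟨i, fun _ => hi⟩
    choose ι hι using hex'
    choose b hb using fun i : σ => exists_coeff_eq (R := R) fun β : σ →₀ ℕ =>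
      if ι (β + Finsupp.single i 1) = i then coeff (β + Finsupp.single i 1) a else 0
    have hab : a = ∑ i, X i * b i := by
      ext α
      rw [map_sum]
      have h1 : ∀ i, coeff α (X i * b i) = if i = ι α then coeff α a else 0 := by
        intro i
        rw [X, coeff_monomial_mul, one_mul]
        split_ifs with h1 h2 h2
        · rw [hb, tsub_add_cancel_of_le h1, if_pos h2.symm]
        · rw [hb, tsub_add_cancel_of_le h1, if_neg (fun h => h2 h.symm)]
        · by_cases h0 : α = 0
          · subst h0
            rw [h _ (by simp)]
          · exfalso
            apply h1
            rw [h2, Finsupp.single_le_iff]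
            exact Nat.one_le_iff_ne_zero.2 (hι α h0)
        · rfl
      simp only [h1, Finset.sum_ite_eq', Finset.mem_univ, if_true]
    rw [hab, pow_succ']
    refine sum_mem fun i _ => Ideal.mul_mem_mul (Ideal.subset_span ⟨i, rfl⟩) (ih _ ?_)
    intro β hβ
    rw [hb]
    split_ifs with h1
    · refine h _ ?_
      rw [map_add, Finsupp.degree_single]
      omega
    · rfl

variable {σ k : Type*} (w : σ → ℕ)

/-- The power series all of whose monomials have weight at least `N`. -/
def weightIdeal (k : Type*) [CommRing k] (N : ℕ) : Ideal (MvPowerSeries σ k) where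
  carrier := {a | ∀ α, Finsupp.weight w α < N → MvPowerSeries.coeff α a = 0}
  add_mem' ha hb α hα := by rw [map_add, ha α hα, hb α hα, add_zero]
  zero_mem' α _ := map_zero _
  smul_mem' c a ha α hα := by
    classical
    rw [smul_eq_mul, MvPowerSeries.coeff_mul]
    refine Finset.sum_eq_zero fun x hx => ?_
    rw [Finset.HasAntidiagonal.mem_antidiagonal] at hx
    rw [ha, mul_zero]
    rw [← hx, map_add] at hα
    omega

theorem mul_mem_weightIdeal [CommRing k] {M N : ℕ} {a b : MvPowerSeries σ k}
    (ha : a ∈ weightIdeal w k M) (hb : b ∈ weightIdeal w k N) :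
    a * b ∈ weightIdeal w k (M + N) := by
  classical
  intro α hα
  rw [MvPowerSeries.coeff_mul]
  refine Finset.sum_eq_zero fun x hx => ?_
  rw [Finset.HasAntidiagonal.mem_antidiagonal] at hx
  rw [← hx, map_add] at hα
  by_cases h : Finsupp.weight w x.1 < M
  · rw [ha _ h, zero_mul]
  · rw [hb x.2 (by omega), mul_zero]

theorem weightIdeal_mono [CommRing k] {M N : ℕ} (h : M ≤ N) :
    weightIdeal w k N ≤ weightIdeal w k M :=
  fun _ ha α hα => ha α (by omega)

theorem X_mem_weightIdeal [CommRing k] (i : σ) :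
    (MvPowerSeries.X i : MvPowerSeries σ k) ∈ weightIdeal w k (w i) := by
  classical
  intro α hα
  rw [MvPowerSeries.coeff_X, if_neg]
  rintro rfl
  rw [Finsupp.weight_single, one_smul] at hα
  exact lt_irrefl _ hα

/-- `g` is the component of weight `N` of `a`, which has no component of smaller weight. -/
def IsWeightSymbol [CommRing k] (N : ℕ) (a : MvPowerSeries σ k) (g : MvPolynomial σ k) : Prop :=
  a ∈ weightIdeal w k N ∧
    ∀ α, g.coeff α = if Finsupp.weight w α = N then MvPowerSeries.coeff α a else 0

variable {w}

theorem IsWeightSymbol.mul [CommRing k] {M N : ℕ} {a b : MvPowerSeries σ k} {g h : MvPolynomial σ k}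
    (ha : IsWeightSymbol w M a g) (hb : IsWeightSymbol w N b h) :
    IsWeightSymbol w (M + N) (a * b) (g * h) := by
  classical
  refine ⟨mul_mem_weightIdeal w ha.1 hb.1, fun α => ?_⟩
  rw [MvPolynomial.coeff_mul]
  split_ifs with hα
  · rw [MvPowerSeries.coeff_mul]
    refine Finset.sum_congr rfl fun x hx => ?_
    rw [Finset.HasAntidiagonal.mem_antidiagonal] at hx
    rw [← hx, map_add] at hα
    rw [ha.2, hb.2]
    split_ifs with h1 h2 h2
    · rfl
    · omega
    · omega
    · by_cases h3 : Finsupp.weight w x.1 < M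
      · rw [ha.1 _ h3, zero_mul, zero_mul]
      · rw [hb.1 x.2 (by omega), mul_zero, mul_zero]
  · refine Finset.sum_eq_zero fun x hx => ?_
    rw [Finset.HasAntidiagonal.mem_antidiagonal] at hx
    rw [← hx, map_add] at hα
    rw [ha.2, hb.2]
    split_ifs with h1 h2
    · omega
    all_goals simp

theorem IsWeightSymbol.sub [CommRing k] {N : ℕ} {a b : MvPowerSeries σ k} {g h : MvPolynomial σ k}
    (ha : IsWeightSymbol w N a g) (hb : IsWeightSymbol w N b h) :
    IsWeightSymbol w N (a - b) (g - h) := by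
  refine ⟨sub_mem ha.1 hb.1, fun α => ?_⟩
  rw [MvPolynomial.coeff_sub, ha.2, hb.2, map_sub]
  split_ifs <;> simp

theorem IsWeightSymbol.add [CommRing k] {N : ℕ} {a b : MvPowerSeries σ k} {g h : MvPolynomial σ k}
    (ha : IsWeightSymbol w N a g) (hb : IsWeightSymbol w N b h) :
    IsWeightSymbol w N (a + b) (g + h) := by
  refine ⟨add_mem ha.1 hb.1, fun α => ?_⟩
  rw [MvPolynomial.coeff_add, ha.2, hb.2, map_add]
  split_ifs <;> simp

theorem IsWeightSymbol.of_mem_succ [CommRing k] {N : ℕ} {a : MvPowerSeries σ k}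
    (ha : a ∈ weightIdeal w k (N + 1)) : IsWeightSymbol w N a 0 := by
  refine ⟨weightIdeal_mono w (Nat.le_succ N) ha, fun α => ?_⟩
  rw [MvPolynomial.coeff_zero]
  split_ifs with h
  · rw [ha α (by omega)]
  · rfl

theorem isWeightSymbol_X [CommRing k] (i : σ) :
    IsWeightSymbol w (w i) (MvPowerSeries.X i : MvPowerSeries σ k) (MvPolynomial.X i) := by
  classical
  refine ⟨X_mem_weightIdeal w i, fun α => ?_⟩
  rw [MvPolynomial.coeff_X, MvPowerSeries.coeff_X]
  by_cases h : α = Finsupp.single i 1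
  · subst h
    simp [Finsupp.weight_single]
  · rw [if_neg (Ne.symm h), if_neg h, ite_self]

theorem isWeightSymbol_C [CommRing k] (c : k) :
    IsWeightSymbol w 0 (MvPowerSeries.C c : MvPowerSeries σ k) (MvPolynomial.C c) := by
  classical
  refine ⟨fun α hα => absurd hα (Nat.not_lt_zero _), fun α => ?_⟩
  rw [MvPolynomial.coeff_C, MvPowerSeries.coeff_C]
  by_cases h : α = 0
  · subst h
    simp
  · rw [if_neg (Ne.symm h), if_neg h, ite_self]

theorem exists_isWeightSymbol [CommRing k] [Finite σ] (hw : ∀ x, w x ≠ 0) {N : ℕ}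
    {a : MvPowerSeries σ k} (ha : a ∈ weightIdeal w k N) :
    ∃ g, IsWeightSymbol w N a g := by
  classical
  have hfin := Finsupp.finite_of_nat_weight_eq w hw N
  refine ⟨∑ α ∈ hfin.toFinset, MvPolynomial.monomial α (MvPowerSeries.coeff α a), ha,
    fun α => ?_⟩
  simp only [MvPolynomial.coeff_sum, MvPolynomial.coeff_monomial, Finset.sum_ite_eq',
    Set.Finite.mem_toFinset, Set.mem_ofPred_eq]

variable (w) in
/-- Symbols of power series over a ring for the weight filtration. -/
def weightSymbols [CommRing k] [Finite σ] (hw : ∀ x, w x ≠ 0) :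
    SymbolCalculus (MvPowerSeries σ k) (MvPolynomial σ k) where
  rel := IsWeightSymbol w
  exists_zero a := exists_isWeightSymbol hw fun α hα => absurd hα (Nat.not_lt_zero _)
  one := by simpa using isWeightSymbol_C (w := w) (1 : k)
  unique h h' := by
    ext α
    rw [h.2, h'.2]
  sub := IsWeightSymbol.sub
  mul := IsWeightSymbol.mul
  succ_of_zero {N a} h := by
    refine exists_isWeightSymbol hw fun α hα => ?_
    rcases Nat.lt_succ_iff_lt_or_eq.1 hα with h1 | h1
    · exact h.1 α h1
    · have := h.2 α
      rwa [if_pos h1, MvPolynomial.coeff_zero, eq_comm] at this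
  of_succ h := IsWeightSymbol.of_mem_succ h.1

/-- Power series over a field whose leading forms for a system of positive weights form a prime
chain form a prime chain themselves. -/
theorem primeChain_of_weightSymbol [Field k] [Finite σ] (hw : ∀ x, w x ≠ 0) {ι : Type*}
    (f : ι → MvPowerSeries σ k) (F : ι → MvPolynomial σ k) (d : ι → ℕ)
    (hfF : ∀ x, IsWeightSymbol w (d x) (f x) (F x)) (L : List ι) (hL : PrimeChain (L.map F)) :
    PrimeChain (L.map f) := by
  classical
  refine (weightSymbols w hw).primeChain f F d hfF ?_ ?_ L hL
  · have key : ∀ L : List ι, ∀ g ∈ Ideal.ofList (L.map F), ∀ M,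
        ∃ b ∈ Ideal.ofList (L.map f), ∃ g', IsWeightSymbol w M b g' ∧
          ∀ α, g'.coeff α = if Finsupp.weight w α = M then g.coeff α else 0 := by
      intro L
      induction L with
      | nil =>
        intro g hg M
        simp only [List.map_nil, Ideal.ofList_nil, Ideal.mem_bot] at hg ⊢
        subst hg
        exact ⟨0, rfl, 0, IsWeightSymbol.of_mem_succ (zero_mem _), by simp⟩
      | cons x L ih =>
        intro g hg M
        simp only [List.map_cons, Ideal.ofList_cons] at hg ⊢
        obtain ⟨u, hu, v, hv, rfl⟩ := Submodule.mem_sup.1 hg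
        obtain ⟨c, rfl⟩ := Ideal.mem_span_singleton'.1 hu
        obtain ⟨b, hb, g', hbg', hg'⟩ := ih v hv M
        by_cases hd : d x ≤ M
        · obtain ⟨cc, hcc⟩ := MvPowerSeries.exists_coeff_eq fun α : σ →₀ ℕ =>
            if Finsupp.weight w α = M - d x then c.coeff α else 0
          have hccw : cc ∈ weightIdeal w k (M - d x) := fun α hα => by
            rw [hcc, if_neg (by omega)]
          obtain ⟨c', hc'⟩ := exists_isWeightSymbol hw hccw
          have h1 := hc'.mul (hfF x)
          rw [Nat.sub_add_cancel hd] at h1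
          refine ⟨cc * f x + b, add_mem (Ideal.mem_sup_left
            (Ideal.mem_span_singleton'.2 ⟨_, rfl⟩)) (Ideal.mem_sup_right hb), _, h1.add hbg', ?_⟩
          intro α
          rw [MvPolynomial.coeff_add, MvPolynomial.coeff_add, hg', MvPolynomial.coeff_mul,
            MvPolynomial.coeff_mul]
          split_ifs with hα
          · congr 1
            refine Finset.sum_congr rfl fun y hy => ?_
            rw [Finset.HasAntidiagonal.mem_antidiagonal] at hy
            rw [← hy, map_add] at hα
            rw [hc'.2, hcc, (hfF x).2]
            split_ifs with h1 h2 h2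
            · rfl
            · rfl
            · omega
            · simp
          · rw [add_zero]
            refine Finset.sum_eq_zero fun y hy => ?_
            rw [Finset.HasAntidiagonal.mem_antidiagonal] at hy
            rw [← hy, map_add] at hα
            rw [hc'.2, (hfF x).2]
            split_ifs with h1 h2 h2
            · omega
            all_goals simp
        · refine ⟨b, Ideal.mem_sup_right hb, g', hbg', fun α => ?_⟩
          rw [hg', MvPolynomial.coeff_add]
          split_ifs with hα
          · rw [MvPolynomial.coeff_mul, Finset.sum_eq_zero, zero_add]
            intro y hy
            rw [Finset.HasAntidiagonal.mem_antidiagonal] at hy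
            rw [← hy, map_add] at hα
            rw [(hfF x).2, if_neg (by omega), mul_zero]
          · rfl
    intro L M a g hag hg
    obtain ⟨b, hb, g', hbg', hg'⟩ := key L g hg M
    refine ⟨b, hb, ?_⟩
    rwa [show g = g' from ?_]
    ext α
    rw [hg', hag.2]
    split_ifs <;> rfl
  · intro L a h
    refine Ideal.mem_of_forall_exists_sub_mem_pow _
      (Ideal.span (Set.range (MvPowerSeries.X : σ → MvPowerSeries σ k))) ?_ _ fun N => ?_
    · intro h1
      have h2 : Ideal.span (Set.range (MvPowerSeries.X : σ → MvPowerSeries σ k)) ≤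
          RingHom.ker MvPowerSeries.constantCoeff := by
        rw [Ideal.span_le]
        rintro _ ⟨i, rfl⟩
        simp
      rw [h1] at h2
      simpa using h2 (show (1 : MvPowerSeries σ k) ∈ ⊤ from Submodule.mem_top)
    · cases nonempty_fintype σ
      obtain ⟨b, hb, g, hg⟩ := h (N * (∑ i, w i + 1))
      refine ⟨b, hb, MvPowerSeries.mem_span_X_pow N _ fun α hα => ?_⟩
      refine hg.1 α ?_
      have h1 : Finsupp.weight w α ≤ α.degree * ∑ i, w i := by
        rw [Finsupp.weight_apply, Finsupp.sum, Finsupp.degree_apply, Finset.sum_mul]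
        exact Finset.sum_le_sum fun i _ => Nat.mul_le_mul_left _
          (Finset.single_le_sum (fun _ _ => Nat.zero_le _) (Finset.mem_univ i))
      refine (h1.trans (Nat.mul_le_mul_left _ (Nat.le_succ _))).trans_lt ?_
      exact Nat.mul_lt_mul_of_pos_right hα (Nat.succ_pos _)

end Weighted

section PolynomialChain

open MvPolynomial

variable {σ k : Type*} [Field k]

theorem MvPolynomial.ringHom_eq_of_notMem_vars {A : Type*} [CommRing A]
    {φ ψ : MvPolynomial σ k →+* A}
    {p : σ} (hC : ∀ c, φ (C c) = ψ (C c)) (hX : ∀ i, i ≠ p → φ (X i) = ψ (X i))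
    {f : MvPolynomial σ k} (hf : p ∉ f.vars) : φ f = ψ f :=
  hom_congr_vars (RingHom.ext hC) (fun i hi _ => hX i fun h => hf (h ▸ hi)) rfl

theorem MvPolynomial.aeval_update_eq_self [DecidableEq σ] {p : σ} {f : MvPolynomial σ k}
    (hf : p ∉ f.vars) (u : MvPolynomial σ k) : aeval (Function.update X p u) f = f :=
  ringHom_eq_of_notMem_vars (φ := (aeval (Function.update X p u)).toRingHom) (ψ := RingHom.id _)
    (fun c => by simp) (fun i hi => by simp [hi]) hf

theorem MvPolynomial.aeval_update_mem_ofList [DecidableEq σ] {p : σ}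
    {l : List (MvPolynomial σ k)} (hl : ∀ f ∈ l, p ∉ f.vars) (u : MvPolynomial σ k)
    {g : MvPolynomial σ k} (hg : g ∈ Ideal.ofList l) :
    aeval (Function.update X p u) g ∈ Ideal.ofList l := by
  have h1 : Ideal.ofList l ≤ (Ideal.ofList l).comap (aeval (Function.update X p u)) := by
    refine Ideal.span_le.2 fun f hf => ?_
    rw [SetLike.mem_coe, Ideal.mem_comap, aeval_update_eq_self (hl f hf)]
    exact Ideal.subset_span hf
  exact h1 hg

theorem MvPolynomial.X_notMem_ofList {p : σ} {l : List (MvPolynomial σ k)}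
    (hP : (Ideal.ofList l).IsPrime) (hl : ∀ f ∈ l, p ∉ f.vars) : X p ∉ Ideal.ofList l := by
  classical
  intro h
  have h1 := aeval_update_mem_ofList hl 1 h
  rw [aeval_X, Function.update_self] at h1
  exact hP.ne_top ((Ideal.eq_top_iff_one _).2 h1)

theorem MvPolynomial.sub_aeval_update_zero_mem [DecidableEq σ] (p : σ) (c : MvPolynomial σ k) :
    ∃ c', c = aeval (Function.update X p 0) c + X p * c' := by
  have h1 : (Ideal.Quotient.mk (Ideal.span {X p})).comp
      (aeval (Function.update (X : σ → MvPolynomial σ k) p 0)).toRingHom =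
      Ideal.Quotient.mk (Ideal.span {X p}) := by
    refine MvPolynomial.ringHom_ext (fun r => by simp) fun i => ?_
    by_cases hi : i = p
    · subst hi
      simp only [AlgHom.toRingHom_eq_coe, RingHom.coe_comp, RingHom.coe_coe, Function.comp_apply,
        aeval_X, Function.update_self, map_zero]
      exact (Ideal.Quotient.eq_zero_iff_mem.2 (Ideal.mem_span_singleton_self _)).symm
    · simp [hi]
  have h2 := RingHom.congr_fun h1 c
  have h3 := Ideal.Quotient.eq.1 h2.symm
  obtain ⟨c', hc'⟩ := Ideal.mem_span_singleton'.1 h3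
  refine ⟨c', ?_⟩
  rw [mul_comm, hc']
  simp

/-- Adjoining a quadric `X p * X q + h` in two new variables to a prime chain. -/
theorem PrimeChain.cons_X_mul_X_add {p q : σ} (hpq : p ≠ q) {l : List (MvPolynomial σ k)}
    (hl : PrimeChain l) (hp : ∀ f ∈ l, p ∉ f.vars) (hq : ∀ f ∈ l, q ∉ f.vars)
    {h : MvPolynomial σ k} (hph : p ∉ h.vars) (hqh : q ∉ h.vars) (hh : h ∉ Ideal.ofList l) :
    PrimeChain ((X p * X q + h) :: l) := by
  classical
  set J := Ideal.ofList l with hJ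
  have hJP : J.IsPrime := hl.isPrime
  set f := X p * X q + h with hf
  have hεf : aeval (Function.update X p (0 : MvPolynomial σ k)) f = h := by
    rw [hf, map_add, map_mul, aeval_X, Function.update_self, zero_mul, zero_add,
      aeval_update_eq_self hph]
  have hXp : X p ∉ J := X_notMem_ofList hJP hp
  refine ⟨hl, fun hfJ => hh ?_, ?_⟩
  · have := aeval_update_mem_ofList hp 0 hfJ
    rwa [hεf] at this
  set I := Ideal.ofList (f :: l) with hI
  have hIdef : I = Ideal.span {f} ⊔ J := Ideal.ofList_cons _ _
  have hfI : f ∈ I := Ideal.subset_span (by simp)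
  have hJI : J ≤ I := hIdef ▸ le_sup_right
  have hreg : ∀ g, X p * g ∈ I → g ∈ I := by
    intro g hg
    rw [hIdef] at hg
    obtain ⟨u, hu, j, hj, huj⟩ := Submodule.mem_sup.1 hg
    obtain ⟨c, rfl⟩ := Ideal.mem_span_singleton'.1 hu
    have h1 := congrArg (aeval (Function.update X p (0 : MvPolynomial σ k))) huj
    rw [map_add, map_mul, map_mul, hεf, aeval_X, Function.update_self, zero_mul] at h1
    have h2 := aeval_update_mem_ofList hp 0 hj
    have h3 : aeval (Function.update X p (0 : MvPolynomial σ k)) c * h ∈ J := by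
      rw [eq_neg_of_add_eq_zero_left h1]
      exact neg_mem h2
    have h4 := (hJP.mem_or_mem h3).resolve_right hh
    obtain ⟨c', hc'⟩ := sub_aeval_update_zero_mem p c
    have h5 : X p * (g - c' * f) ∈ J := by
      rw [show X p * (g - c' * f) = aeval (Function.update X p (0 : MvPolynomial σ k)) c * f + j
        from by linear_combination (-1 : MvPolynomial σ k) * huj + f * hc']
      exact add_mem (Ideal.mul_mem_right _ _ h4) hj
    have h6 := (hJP.mem_or_mem h5).resolve_left hXp
    rw [show g = (g - c' * f) + c' * f by ring]
    exact add_mem (hJI h6) (Ideal.mul_mem_left _ _ hfI)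
  have hregN : ∀ N g, X p ^ N * g ∈ I → g ∈ I := by
    intro N
    induction N with
    | zero => intro g hg; simpa using hg
    | succ N ih => intro g hg; exact ih g (hreg _ (by rwa [← mul_assoc, ← pow_succ']))
  have helim : ∀ g : MvPolynomial σ k, ∃ N, ∃ g' ∈ supported k ({q}ᶜ : Set σ),
      X p ^ N * g - g' ∈ Ideal.span {f} := by
    intro g
    have hpS : (X p : MvPolynomial σ k) ∈ supported k ({q}ᶜ : Set σ) := X_mem_supported.2 hpq
    induction g using MvPolynomial.induction_on with
    | C a => exact ⟨0, C a, Subalgebra.algebraMap_mem _ a, by simp⟩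
    | add g₁ g₂ h₁ h₂ =>
      obtain ⟨N₁, g₁', hs₁, hg₁⟩ := h₁
      obtain ⟨N₂, g₂', hs₂, hg₂⟩ := h₂
      refine ⟨N₁ + N₂, X p ^ N₂ * g₁' + X p ^ N₁ * g₂', add_mem (mul_mem (pow_mem hpS _) hs₁)
        (mul_mem (pow_mem hpS _) hs₂), ?_⟩
      rw [show X p ^ (N₁ + N₂) * (g₁ + g₂) - (X p ^ N₂ * g₁' + X p ^ N₁ * g₂') =
        X p ^ N₂ * (X p ^ N₁ * g₁ - g₁') + X p ^ N₁ * (X p ^ N₂ * g₂ - g₂') by ring]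
      exact add_mem (Ideal.mul_mem_left _ _ hg₁) (Ideal.mul_mem_left _ _ hg₂)
    | mul_X g i h₁ =>
      obtain ⟨N, g', hs, hg⟩ := h₁
      by_cases hi : i = q
      · subst hi
        refine ⟨N + 1, -(g' * h), neg_mem (mul_mem hs (mem_supported.2 ?_)), ?_⟩
        · intro j hj
          rw [Set.mem_compl_iff, Set.mem_singleton_iff]
          rintro rfl
          exact hqh hj
        · rw [show X p ^ (N + 1) * (g * X i) - -(g' * h) =
            (X p ^ N * g) * f - (X p ^ N * g - g') * h by rw [hf]; ring]
          exact sub_mem (Ideal.mul_mem_left _ _ (Ideal.mem_span_singleton_self _))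
            (Ideal.mul_mem_right _ _ hg)
      · refine ⟨N, g' * X i, mul_mem hs (X_mem_supported.2 hi), ?_⟩
        rw [← mul_assoc, ← sub_mul]
        exact Ideal.mul_mem_right _ _ hg
  let K := FractionRing (MvPolynomial σ k ⧸ J)
  let κ : MvPolynomial σ k →+* K := (algebraMap (MvPolynomial σ k ⧸ J) K).comp (Ideal.Quotient.mk J)
  have hκ : ∀ g, κ g = 0 ↔ g ∈ J := fun g => by
    rw [RingHom.comp_apply, map_eq_zero_iff _ (IsFractionRing.injective _ K),
      Ideal.Quotient.eq_zero_iff_mem]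
  let Ψ : MvPolynomial σ k →+* K :=
    eval₂Hom (κ.comp C) (Function.update (fun i => κ (X i)) q (-κ h / κ (X p)))
  have hΨ : ∀ g : MvPolynomial σ k, q ∉ g.vars → Ψ g = κ g := fun g hg =>
    ringHom_eq_of_notMem_vars (fun c => by simp [Ψ]) (fun i hi => by simp [Ψ, hi]) hg
  have hΨf : Ψ f = 0 := by
    have h0 : κ (X p) ≠ 0 := fun h0 => hXp ((hκ _).1 h0)
    rw [hf, map_add, map_mul, hΨ h hqh, hΨ (X p) (by simpa using hpq.symm)]
    simp only [Ψ, eval₂Hom_X', Function.update_self]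
    rw [mul_div_cancel₀ _ h0, neg_add_cancel]
  have hker : I = RingHom.ker Ψ := by
    refine le_antisymm (Ideal.span_le.2 fun g hg => ?_) fun g hg => ?_
    · rw [SetLike.mem_coe, RingHom.mem_ker]
      rcases List.mem_cons.1 hg with rfl | hg
      · exact hΨf
      · rw [hΨ g (hq g hg), hκ]
        exact Ideal.subset_span hg
    · obtain ⟨N, g', hs, hg'⟩ := helim g
      have hq' : q ∉ g'.vars := fun hq' => mem_supported.1 hs hq' rfl
      obtain ⟨c, hc⟩ := Ideal.mem_span_singleton'.1 hg'
      have h1 := congrArg Ψ hc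
      rw [map_mul, hΨf, mul_zero, map_sub, map_mul, (RingHom.mem_ker).1 hg, mul_zero, zero_sub,
        eq_comm, neg_eq_zero, hΨ g' hq', hκ] at h1
      refine hregN N g ?_
      rw [show X p ^ N * g = c * f + g' by rw [hc]; ring]
      exact add_mem (Ideal.mul_mem_left _ _ hfI) (hJI h1)
  rw [hker]
  exact RingHom.ker_isPrime Ψ

end PolynomialChain

section Quadrics

open MvPolynomial

variable {σ k ι : Type*} [Field k]

theorem MvPolynomial.mem_vars_quadric {p q p' q' u : σ}
    (hu : u ∈ (X p * X q + X p' * X q' : MvPolynomial σ k).vars) :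
    u = p ∨ u = q ∨ u = p' ∨ u = q' := by
  classical
  rcases Finset.mem_union.1 (vars_add_subset _ _ hu) with h | h <;>
    rcases Finset.mem_union.1 (vars_mul _ _ h) with h | h <;>
    simp_all [vars_X]

/-- Quadrics `X p * X q + X p' * X q'`, ordered so that each one involves two variables that do not
occur in its predecessors, form a prime chain on top of a variable that they do not involve. -/
theorem exists_primeChain_quadrics [Fintype ι] [DecidableEq ι] (p q p' q' : ι → σ) (t : σ)
    (level : ι → ℕ) {c : k} (hc : c ≠ 0)
    (hpq : ∀ x, p x ≠ q x) (hpq' : ∀ x, p' x ≠ q' x)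
    (hpt : ∀ x, p x ≠ t) (hqt : ∀ x, q x ≠ t) (hpt' : ∀ x, p' x ≠ t) (hqt' : ∀ x, q' x ≠ t)
    (hx : ∀ x, p x ≠ p' x ∧ p x ≠ q' x ∧ q x ≠ p' x ∧ q x ≠ q' x)
    (hxy : ∀ x y, y ≠ x → level y ≤ level x →
      (p x ≠ p y ∧ p x ≠ q y ∧ p x ≠ p' y ∧ p x ≠ q' y) ∧
      (q x ≠ p y ∧ q x ≠ q y ∧ q x ≠ p' y ∧ q x ≠ q' y)) :
    ∃ l : List ι, (∀ x, x ∈ l) ∧ PrimeChain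
      (l.map (fun x => (X (p x) * X (q x) + X (p' x) * X (q' x) : MvPolynomial σ k)) ++
        [C c * X t]) := by
  classical
  set F : ι → MvPolynomial σ k := fun x => X (p x) * X (q x) + X (p' x) * X (q' x) with hF
  suffices h : ∀ s : Finset ι, ∃ l : List ι, (∀ x, x ∈ l ↔ x ∈ s) ∧
      PrimeChain (l.map F ++ [C c * X t]) by
    obtain ⟨l, hl, h⟩ := h Finset.univ
    exact ⟨l, fun x => (hl x).2 (Finset.mem_univ x), h⟩
  intro s
  induction s using Finset.induction_on_max_value level with
  | empty =>
    refine ⟨[], by simp, ?_⟩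
    have hu : IsUnit (C c : MvPolynomial σ k) := (isUnit_iff_ne_zero.2 hc).map C
    have hX : (C c * X t : MvPolynomial σ k) ≠ 0 := mul_ne_zero hu.ne_zero (X_ne_zero t)
    refine ⟨Ideal.isPrime_bot, ?_, ?_⟩
    · rwa [Ideal.ofList_nil, Ideal.mem_bot]
    · rw [Ideal.ofList_cons, Ideal.ofList_nil, sup_bot_eq, Ideal.span_singleton_prime hX]
      exact ((associated_unit_mul_left (X t : MvPolynomial σ k) _ hu).prime_iff).2 X_prime
  | insert a s has hmax ih =>
    obtain ⟨l, hl, hch⟩ := ih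
    refine ⟨a :: l, fun x => by rw [List.mem_cons, Finset.mem_insert, hl], ?_⟩
    have hmem : ∀ f ∈ l.map F ++ [C c * X t], f = C c * X t ∨ ∃ y ∈ s, f = F y := by
      intro f hf
      rcases List.mem_append.1 hf with hf | hf
      · obtain ⟨y, hy, rfl⟩ := List.mem_map.1 hf
        exact Or.inr ⟨y, (hl y).1 hy, rfl⟩
      · exact Or.inl (by simpa using hf)
    have hvar : ∀ u, u ≠ t → (∀ y, y ≠ a → level y ≤ level a →
        u ≠ p y ∧ u ≠ q y ∧ u ≠ p' y ∧ u ≠ q' y) →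
        ∀ f ∈ l.map F ++ [C c * X t], u ∉ f.vars := by
      intro u hut hu f hf hfu
      rcases hmem f hf with rfl | ⟨y, hy, rfl⟩
      · rcases Finset.mem_union.1 (vars_mul _ _ hfu) with h | h
        · simp at h
        · rw [vars_X, Finset.mem_singleton] at h
          exact hut h
      · obtain ⟨h1, h2, h3, h4⟩ := hu y (fun h => has (h ▸ hy)) (hmax y hy)
        rcases mem_vars_quadric hfu with h | h | h | h
        exacts [h1 h, h2 h, h3 h, h4 h]
    have hX : ∀ u, u ≠ t → (X u : MvPolynomial σ k) ∉ Ideal.ofList (l.map F ++ [C c * X t]) := by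
      intro u hut h
      have h1 : Ideal.ofList (l.map F ++ [C c * X t]) ≤
          RingHom.ker (eval (Pi.single u (1 : k))) := by
        refine Ideal.span_le.2 fun f hf => ?_
        rw [SetLike.mem_coe, RingHom.mem_ker]
        have h0 : ∀ v w, v ≠ w → (Pi.single u (1 : k) : σ → k) v * (Pi.single u (1 : k) : σ → k) w
            = 0 := by
          intro v w hvw
          by_cases hv : v = u
          · rw [Pi.single_eq_of_ne (fun hw => hvw (hv.trans hw.symm)), mul_zero]
          · rw [Pi.single_eq_of_ne hv, zero_mul]
        rcases hmem f hf with rfl | ⟨y, hy, rfl⟩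
        · rw [map_mul, eval_X, Pi.single_eq_of_ne hut.symm, mul_zero]
        · simp only [hF, map_add, map_mul, eval_X]
          rw [h0 _ _ (hpq y), h0 _ _ (hpq' y), add_zero]
      have h2 := h1 h
      simp at h2
    obtain ⟨h1, h2, h3, h4⟩ := hx a
    refine PrimeChain.cons_X_mul_X_add (hpq a) hch
      (hvar _ (hpt a) fun y hy hya => (hxy a y hy hya).1)
      (hvar _ (hqt a) fun y hy hya => (hxy a y hy hya).2) ?_ ?_ ?_
    · intro h
      rcases Finset.mem_union.1 (vars_mul _ _ h) with h | h <;> simp_all [vars_X]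
    · intro h
      rcases Finset.mem_union.1 (vars_mul _ _ h) with h | h <;> simp_all [vars_X]
    · exact fun h => (hch.isPrime.mem_or_mem h).elim (hX _ (hpt' a)) (hX _ (hqt' a))

end Quadrics

section RelationWord

variable {R R' : Type*} [CommRing R] [CommRing R'] {n : ℕ}

/-- The Demuškin word `U₀ ^ q [U₀, U₁] [U₂, U₃] ⋯` in a family of matrices. -/
def relWord (q m : ℕ) (U : Fin (2 * m + 2) → Matrix (Fin n) (Fin n) R) : Matrix (Fin n) (Fin n) R :=
  U ⟨0, by omega⟩ ^ q * (List.ofFn fun i : Fin (m + 1) =>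
    matComm (U ⟨2 * i, by have := i.isLt; omega⟩) (U ⟨2 * i + 1, by have := i.isLt; omega⟩)).prod

theorem Matrix.map_inv_of_isUnit_det (φ : R →+* R') {A : Matrix (Fin n) (Fin n) R}
    (hA : IsUnit A.det) : φ.mapMatrix A⁻¹ = (φ.mapMatrix A)⁻¹ := by
  refine (Matrix.inv_eq_right_inv ?_).symm
  rw [← map_mul, Matrix.mul_nonsing_inv _ hA, map_one]

theorem map_matComm (φ : R →+* R') {A B : Matrix (Fin n) (Fin n) R}
    (hA : IsUnit A.det) (hB : IsUnit B.det) :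
    φ.mapMatrix (matComm A B) = matComm (φ.mapMatrix A) (φ.mapMatrix B) := by
  rw [matComm, matComm, map_mul, map_mul, map_mul, Matrix.map_inv_of_isUnit_det φ hA,
    Matrix.map_inv_of_isUnit_det φ hB]

theorem map_relWord (φ : R →+* R') (q m : ℕ) (U : Fin (2 * m + 2) → Matrix (Fin n) (Fin n) R)
    (hU : ∀ i, IsUnit (U i).det) :
    φ.mapMatrix (relWord q m U) = relWord q m fun i => φ.mapMatrix (U i) := by
  rw [relWord, relWord, map_mul, map_pow, map_list_prod, List.map_ofFn]
  congr 3
  funext i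
  exact map_matComm φ (hU _) (hU _)

theorem det_matComm {A B : Matrix (Fin n) (Fin n) R} (hA : IsUnit A.det) (hB : IsUnit B.det) :
    (matComm A B).det = 1 := by
  have h1 : A.det * A⁻¹.det = 1 := by
    rw [← Matrix.det_mul, Matrix.mul_nonsing_inv _ hA, Matrix.det_one]
  have h2 : B.det * B⁻¹.det = 1 := by
    rw [← Matrix.det_mul, Matrix.mul_nonsing_inv _ hB, Matrix.det_one]
  rw [matComm, Matrix.det_mul, Matrix.det_mul, Matrix.det_mul]
  linear_combination h1 * B.det * B⁻¹.det + h2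

theorem det_relWord (q m : ℕ) (U : Fin (2 * m + 2) → Matrix (Fin n) (Fin n) R)
    (hU : ∀ i, IsUnit (U i).det) : (relWord q m U).det = (U ⟨0, by omega⟩).det ^ q := by
  have h : ∀ l : List (Matrix (Fin n) (Fin n) R), (∀ M ∈ l, M.det = 1) → l.prod.det = 1 := by
    intro l hl
    induction l with
    | nil => simp
    | cons M l ih =>
      rw [List.prod_cons, Matrix.det_mul, hl M (by simp), one_mul]
      exact ih fun N hN => hl N (by simp [hN])
  rw [relWord, Matrix.det_mul, Matrix.det_pow, h, mul_one]
  intro M hM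
  obtain ⟨i, rfl⟩ := List.mem_ofFn.1 hM
  exact det_matComm (hU _) (hU _)

theorem Matrix.mul_mem_idealMatrix {I J K : Ideal R} (hIJ : ∀ a ∈ I, ∀ b ∈ J, a * b ∈ K)
    {A B : Matrix (Fin n) (Fin n) R} (hA : A ∈ I.matrix (Fin n)) (hB : B ∈ J.matrix (Fin n)) :
    A * B ∈ K.matrix (Fin n) := fun i j => by
  rw [Matrix.mul_apply]
  exact sum_mem fun l _ => hIJ _ (hA i l) _ (hB l j)

theorem Matrix.mul_mem_idealMatrix_right {I : Ideal R} {A : Matrix (Fin n) (Fin n) R}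
    (hA : A ∈ I.matrix (Fin n)) (B : Matrix (Fin n) (Fin n) R) : A * B ∈ I.matrix (Fin n) :=
  fun i j => by
    rw [Matrix.mul_apply]
    exact sum_mem fun l _ => I.mul_mem_right _ (hA i l)

/-- The commutator of `u + A` and `1 + B` is `1 + (AB - BA)` up to terms of higher order. -/
theorem matComm_sub_mem {I J K : Ideal R} (hIJ : ∀ a ∈ J, ∀ b ∈ I, a * b ∈ K)
    {t : R} {A B : Matrix (Fin n) (Fin n) R} (ht : t ∈ I) (hA : A ∈ I.matrix (Fin n))
    (hB : B ∈ I.matrix (Fin n)) (hAB : A * B - B * A ∈ J.matrix (Fin n))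
    (hA' : IsUnit ((1 + t) • 1 + A).det) (hB' : IsUnit (1 + B).det) :
    matComm ((1 + t) • 1 + A) (1 + B) - 1 - (A * B - B * A) ∈ K.matrix (Fin n) := by
  set X := (1 + t) • 1 + A with hX
  set Y := 1 + B with hY
  have h1 : X * Y - Y * X = A * B - B * A := by
    rw [hX, hY]
    simp only [add_mul, mul_add, smul_mul_assoc, mul_smul_comm, one_mul, mul_one, smul_add]
    abel
  have hYX : Y * X * (X⁻¹ * Y⁻¹) = 1 := by
    rw [mul_assoc, Matrix.mul_nonsing_inv_cancel_left _ _ hA', Matrix.mul_nonsing_inv _ hB']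
  have hXY : X⁻¹ * Y⁻¹ * (Y * X) = 1 := by
    rw [mul_assoc, Matrix.nonsing_inv_mul_cancel_left _ _ hB', Matrix.nonsing_inv_mul _ hA']
  have h2 : matComm X Y - 1 - (A * B - B * A) = (A * B - B * A) * (X⁻¹ * Y⁻¹ - 1) := by
    rw [← h1, mul_sub, sub_mul, hYX, mul_one, matComm, mul_assoc (X * Y)]
  have h3 : X⁻¹ * Y⁻¹ - 1 = X⁻¹ * Y⁻¹ * (1 - Y * X) := by rw [mul_sub, hXY, mul_one]
  have h4 : 1 - Y * X ∈ I.matrix (Fin n) := by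
    have ht' : t • (1 : Matrix (Fin n) (Fin n) R) ∈ I.matrix (Fin n) := fun i j => by
      rw [Matrix.smul_apply, smul_eq_mul]
      exact I.mul_mem_right _ ht
    have : 1 - Y * X = -(B * X + A + t • 1) := by
      rw [hX, hY, add_smul, one_smul]
      simp only [add_mul, one_mul]
      abel
    rw [this]
    exact neg_mem (add_mem (add_mem (Matrix.mul_mem_idealMatrix_right hB _) hA) ht')
  rw [h2, h3]
  exact Matrix.mul_mem_idealMatrix hIJ hAB (Ideal.mul_mem_left _ _ h4)

theorem List.prod_sub_one_mem_idealMatrix {I : Ideal R} (l : List (Matrix (Fin n) (Fin n) R))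
    (hl : ∀ M ∈ l, M - 1 ∈ I.matrix (Fin n)) : l.prod - 1 ∈ I.matrix (Fin n) := by
  induction l with
  | nil => simp
  | cons M l ih =>
    rw [List.prod_cons, show M * l.prod - 1 = M * (l.prod - 1) + (M - 1) by
      rw [mul_sub, mul_one]; abel]
    exact add_mem (Ideal.mul_mem_left _ _ (ih fun N hN => hl N (by simp [hN]))) (hl M (by simp))

end RelationWord

section LeadingTerms

variable {σ k : Type*} [CommRing k] {n : ℕ} (w : σ → ℕ)

theorem pow_mem_weightIdeal {N : ℕ} {a : MvPowerSeries σ k} (ha : a ∈ weightIdeal w k N) (q : ℕ) :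
    a ^ q ∈ weightIdeal w k (q * N) := by
  induction q with
  | zero => intro α hα; omega
  | succ q ih =>
    rw [pow_succ, Nat.succ_mul]
    exact mul_mem_weightIdeal w ih ha

theorem pow_mem_weightIdeal_matrix {N : ℕ} {A : Matrix (Fin n) (Fin n) (MvPowerSeries σ k)}
    (hA : A ∈ (weightIdeal w k N).matrix (Fin n)) (q : ℕ) :
    A ^ q ∈ (weightIdeal w k (q * N)).matrix (Fin n) := by
  induction q with
  | zero => intro i j α hα; omega
  | succ q ih =>
    rw [pow_succ, Nat.succ_mul]
    exact Matrix.mul_mem_idealMatrix (I := weightIdeal w k (q * N)) (J := weightIdeal w k N)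
      (K := weightIdeal w k (q * N + N)) (fun a ha b hb => mul_mem_weightIdeal w ha hb) ih hA

/-- The quadratic part of the Demuškin word near the identity in characteristic `p`. -/
theorem relWord_sub_mem {p s m N D : ℕ} [Fact p.Prime] [CharP k p] (hm : 1 ≤ m)
    (hq3 : 3 ≤ p ^ s) (hn : 1 ≤ n) (hD3 : D ≤ 3 * N) (hD4 : D ≤ 4 * N) (t : MvPowerSeries σ k)
    (ht : t ∈ weightIdeal w k N)
    (B : Fin (2 * m + 2) → Matrix (Fin n) (Fin n) (MvPowerSeries σ k))
    (hB : ∀ i, B i ∈ (weightIdeal w k N).matrix (Fin n))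
    (hB' : ∀ i : Fin (2 * m + 2), 4 ≤ i.1 → B i ∈ (weightIdeal w k (2 * N)).matrix (Fin n))
    (U : Fin (2 * m + 2) → Matrix (Fin n) (Fin n) (MvPowerSeries σ k))
    (hU0 : U ⟨0, by omega⟩ = (1 + t) • 1 + B ⟨0, by omega⟩)
    (hU : ∀ i : Fin (2 * m + 2), i.1 ≠ 0 → U i = 1 + B i)
    (hdet : ∀ i, IsUnit (U i).det) :
    relWord (p ^ s) m U - 1 -
      ((B ⟨0, by omega⟩ * B ⟨1, by omega⟩ - B ⟨1, by omega⟩ * B ⟨0, by omega⟩) +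
        (B ⟨2, by omega⟩ * B ⟨3, by omega⟩ - B ⟨3, by omega⟩ * B ⟨2, by omega⟩)) ∈
      (weightIdeal w k D).matrix (Fin n) := by
  obtain ⟨m, rfl⟩ : ∃ m', m = m' + 1 := ⟨m - 1, by omega⟩
  have hmul : ∀ M N, ∀ a ∈ weightIdeal w k M, ∀ b ∈ weightIdeal w k N,
    a * b ∈ weightIdeal w k (M + N) := fun M N a ha b hb => mul_mem_weightIdeal w ha hb
  have hmono : ∀ {M N : ℕ}, N ≤ M → ∀ {A : Matrix (Fin n) (Fin n) (MvPowerSeries σ k)},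
      A ∈ (weightIdeal w k M).matrix (Fin n) → A ∈ (weightIdeal w k N).matrix (Fin n) :=
    fun h A hA i j => weightIdeal_mono w h (hA i j)
  have hbr : ∀ {M : ℕ} {A B : Matrix (Fin n) (Fin n) (MvPowerSeries σ k)},
      A ∈ (weightIdeal w k M).matrix (Fin n) → B ∈ (weightIdeal w k M).matrix (Fin n) →
      A * B - B * A ∈ (weightIdeal w k (M + M)).matrix (Fin n) := fun {M A B} hA hB =>
    sub_mem (Matrix.mul_mem_idealMatrix (hmul M M) hA hB)
      (Matrix.mul_mem_idealMatrix (hmul M M) hB hA)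
  have hcomm : ∀ {M D : ℕ}, D ≤ M + M + M → ∀ {u : MvPowerSeries σ k}
      {A B X Y : Matrix (Fin n) (Fin n) (MvPowerSeries σ k)}, u ∈ weightIdeal w k M →
      A ∈ (weightIdeal w k M).matrix (Fin n) → B ∈ (weightIdeal w k M).matrix (Fin n) →
      X = (1 + u) • 1 + A → Y = 1 + B → IsUnit X.det → IsUnit Y.det →
      matComm X Y - 1 - (A * B - B * A) ∈ (weightIdeal w k D).matrix (Fin n) := by
    intro M D hD u A B X Y hu hA hB hX hY hX' hY'
    subst hX hY
    exact matComm_sub_mem (I := weightIdeal w k M) (J := weightIdeal w k (M + M))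
      (K := weightIdeal w k D) (fun a ha b hb => weightIdeal_mono w hD (hmul _ _ a ha b hb))
      hu hA hB (hbr hA hB) hX' hY'
  have hpow : U ⟨0, by omega⟩ ^ p ^ s - 1 ∈ (weightIdeal w k D).matrix (Fin n) := by
    have : Nonempty (Fin n) := ⟨⟨0, hn⟩⟩
    have : CharP (MvPowerSeries σ k) p :=
      charP_of_injective_ringHom (f := MvPowerSeries.C) MvPowerSeries.C_injective p
    have h1 : U ⟨0, by omega⟩ ^ p ^ s - 1 =
        t ^ p ^ s • (1 : Matrix (Fin n) (Fin n) (MvPowerSeries σ k)) +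
          B ⟨0, by omega⟩ ^ p ^ s := by
      rw [hU0, add_pow_char_pow_of_commute p s
        ((Commute.one_left _).smul_left _), smul_pow, one_pow, add_pow_char_pow, one_pow,
        add_smul, one_smul]
      abel
    have hD : D ≤ p ^ s * N := hD3.trans (Nat.mul_le_mul_right N hq3)
    rw [h1]
    refine add_mem (fun i j => ?_) (hmono hD (pow_mem_weightIdeal_matrix w (hB _) _))
    rw [Matrix.smul_apply, smul_eq_mul]
    exact Ideal.mul_mem_right _ _ (weightIdeal_mono w hD (pow_mem_weightIdeal w ht _))
  have hrest : ∀ i : Fin m, matComm (U ⟨2 * (i + 2), by omega⟩) (U ⟨2 * (i + 2) + 1, by omega⟩) - 1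
      ∈ (weightIdeal w k D).matrix (Fin n) := by
    intro i
    have h1 := hcomm (M := 2 * N) (D := D) (by omega) (zero_mem _)
      (hB' ⟨2 * (i + 2), by omega⟩ (by simp; omega))
      (hB' ⟨2 * (i + 2) + 1, by omega⟩ (by simp; omega))
      (by rw [add_zero, one_smul]; exact hU ⟨2 * (i + 2), by omega⟩ (by simp))
      (hU ⟨2 * (i + 2) + 1, by omega⟩ (by simp)) (hdet _) (hdet _)
    have h2 := add_mem h1 (hmono (show D ≤ 2 * N + 2 * N by omega)
      (hbr (hB' ⟨2 * (i + 2), by omega⟩ (by simp; omega))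
        (hB' ⟨2 * (i + 2) + 1, by omega⟩ (by simp; omega))))
    rwa [sub_add_cancel] at h2
  have h01 := hcomm (M := N) (D := D) (by omega) ht (hB ⟨0, by omega⟩) (hB ⟨1, by omega⟩) hU0
    (hU ⟨1, by omega⟩ (by simp)) (hdet _) (hdet _)
  have h23 := hcomm (M := N) (D := D) (by omega) (zero_mem _) (hB ⟨2, by omega⟩)
    (hB ⟨3, by omega⟩) (by rw [add_zero, one_smul]; exact hU ⟨2, by omega⟩ (by simp))
    (hU ⟨3, by omega⟩ (by simp)) (hdet _) (hdet _)
  have hc01 := hbr (hB ⟨0, by omega⟩) (hB ⟨1, by omega⟩)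
  have hc23 := hbr (hB ⟨2, by omega⟩) (hB ⟨3, by omega⟩)
  rw [relWord, List.ofFn_succ, List.prod_cons, List.ofFn_succ, List.prod_cons]
  have hR := List.prod_sub_one_mem_idealMatrix (I := weightIdeal w k D)
    (List.ofFn fun i : Fin m =>
      matComm (U ⟨2 * (i + 2), by omega⟩) (U ⟨2 * (i + 2) + 1, by omega⟩)) (by
    intro M hM
    obtain ⟨i, rfl⟩ := List.mem_ofFn.1 hM
    exact hrest i)
  set P := U ⟨0, by omega⟩ ^ p ^ s
  set R := (List.ofFn fun i : Fin m =>
      matComm (U ⟨2 * (i + 2), by omega⟩) (U ⟨2 * (i + 2) + 1, by omega⟩)).prod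
  set C := B ⟨0, by omega⟩ * B ⟨1, by omega⟩ - B ⟨1, by omega⟩ * B ⟨0, by omega⟩
  set C' := B ⟨2, by omega⟩ * B ⟨3, by omega⟩ - B ⟨3, by omega⟩ * B ⟨2, by omega⟩
  set M := matComm (U ⟨0, by omega⟩) (U ⟨1, by omega⟩)
  set M' := matComm (U ⟨2, by omega⟩) (U ⟨3, by omega⟩)
  change P * (M * (M' * R)) - 1 - (C + C') ∈ _
  have hM' : M' - 1 ∈ (weightIdeal w k (N + N)).matrix (Fin n) := by
    have := add_mem (hcomm (M := N) (D := N + N) (by omega) (zero_mem _) (hB ⟨2, by omega⟩)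
      (hB ⟨3, by omega⟩) (by rw [add_zero, one_smul]; exact hU ⟨2, by omega⟩ (by simp))
      (hU ⟨3, by omega⟩ (by simp)) (hdet _) (hdet _)) hc23
    rwa [sub_add_cancel] at this
  have hM : M - 1 ∈ (weightIdeal w k (N + N)).matrix (Fin n) := by
    have := add_mem (hcomm (M := N) (D := N + N) (by omega) ht (hB ⟨0, by omega⟩)
      (hB ⟨1, by omega⟩) hU0 (hU ⟨1, by omega⟩ (by simp)) (hdet _) (hdet _)) hc01
    rwa [sub_add_cancel] at this
  have hMM := Matrix.mul_mem_idealMatrix (hmul (N + N) (N + N)) hM hM'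
  have hid : P * (M * (M' * R)) - 1 - (C + C') = (P - 1) * (M * (M' * R)) + M * M' * (R - 1) +
      (M - 1) * (M' - 1) + (M - 1 - C) + (M' - 1 - C') := by
    simp only [mul_sub, sub_mul, mul_assoc, one_mul, mul_one]
    abel
  rw [hid]
  exact add_mem (add_mem (add_mem (add_mem (Matrix.mul_mem_idealMatrix_right hpow _)
    (Ideal.mul_mem_left _ _ hR)) (hmono (by omega) hMM)) h01) h23

end LeadingTerms

section QuadricWeights

/-- The weight of the distinguished variable. -/
def baseWeight (n : ℕ) : ℕ := 3 + n ^ 2 + 5 * n ^ 2 * n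

/-- The weight of the entry `(i, l)` of the first matrix. -/
def rowWeight (n i l : ℕ) : ℕ := baseWeight n + 1 + l * (l + 1) + (5 * n ^ 2 - 2 * l) * i

/-- The weight of the entry `(l, j)` of the second matrix. -/
def colWeight (n l j : ℕ) : ℕ := baseWeight n + 1 + (5 * n ^ 2 - 2 * l) * (n - j)

/-- The weight of the leading term of the entry `(i, j)` of the sum of two commutators. -/
def quadricDegree (n i j : ℕ) : ℕ :=
  2 * baseWeight n + 2 + 5 * n ^ 2 * (n - ((i - j) + (j - i))) + (n - ((i - j) + (j - i))) -
    (n - ((i - j) + (j - i))) ^ 2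

variable {n i j l : ℕ}

theorem quadricDegree_comm (n i j : ℕ) : quadricDegree n i j = quadricDegree n j i := by
  rw [quadricDegree, quadricDegree, add_comm (i - j)]

theorem cast_rowWeight (hl : l < n) :
    (rowWeight n i l : ℤ) = baseWeight n + 1 + l * (l + 1) + (5 * n ^ 2 - 2 * l) * i := by
  have h : 2 * l ≤ 5 * n ^ 2 := by nlinarith
  rw [rowWeight]
  push_cast [h]
  ring

theorem cast_colWeight (hl : l < n) (hj : j < n) :
    (colWeight n l j : ℤ) = baseWeight n + 1 + (5 * n ^ 2 - 2 * l) * (n - j) := by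
  have h : 2 * l ≤ 5 * n ^ 2 := by nlinarith
  rw [colWeight]
  push_cast [h, hj.le]
  ring

theorem cast_quadricDegree (hij : i ≤ j) (hj : j < n) :
    (quadricDegree n i j : ℤ) =
      2 * baseWeight n + 2 + 5 * n ^ 2 * (n - (j - i)) + (n - (j - i)) - (n - (j - i)) ^ 2 := by
  obtain ⟨c, hc⟩ : ∃ c, c = n - ((i - j) + (j - i)) := ⟨_, rfl⟩
  have hc' : (c : ℤ) = n - (j - i) := by omega
  have h : c ^ 2 ≤ 2 * baseWeight n + 2 + 5 * n ^ 2 * c + c := by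
    have : c ≤ n := by omega
    nlinarith [Nat.zero_le (n ^ 2 * c), Nat.zero_le (baseWeight n), pow_le_pow_left' this 2,
      show n ^ 2 ≤ baseWeight n by rw [baseWeight]; nlinarith [Nat.zero_le (5 * n ^ 2 * n)]]
  rw [quadricDegree, ← hc, ← hc']
  push_cast [h]
  ring

theorem rowWeight_add_colWeight (hij : i ≤ j) (hj : j < n) (hl : l < n)
    (h : l = n - 1 - (j - i) ∨ l = n - max (j - i) 1) :
    rowWeight n i l + colWeight n l j = quadricDegree n i j := by
  zify
  rw [cast_rowWeight hl, cast_colWeight hl hj, cast_quadricDegree hij hj]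
  rcases h with h | h
  · have : (l : ℤ) = n - 1 - (j - i) := by omega
    rw [this]
    ring
  · rcases hij.eq_or_lt with rfl | hij
    · have : (l : ℤ) = n - 1 := by omega
      rw [this]
      ring
    · have : (l : ℤ) = n - (j - i) := by omega
      rw [this]
      ring

theorem quadricDegree_lt_of_ne (hij : i ≤ j) (hj : j < n) (hl : l < n)
    (h1 : l ≠ n - 1 - (j - i)) (h2 : l ≠ n - max (j - i) 1) :
    quadricDegree n i j < rowWeight n i l + colWeight n l j := by
  zify
  rw [cast_rowWeight hl, cast_colWeight hl hj, cast_quadricDegree hij hj]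
  obtain ⟨c, hc⟩ : ∃ c : ℤ, c = n - (j - i) := ⟨_, rfl⟩
  have h3 : (l : ℤ) < c - 1 ∨ c < l := by omega
  have h4 : 0 < ((l : ℤ) - c) * (l - c + 1) := by
    rcases h3 with h3 | h3 <;> nlinarith
  rw [← hc]
  have : (n : ℤ) = c + (j - i) := by rw [hc]; ring
  linear_combination (exp := 1) h4 + (2 * (l : ℤ) - 5 * (n : ℤ) ^ 2) * this

theorem quadricDegree_lt_of_lt (hij : i < j) (hj : j < n) (hl : l < n) :
    quadricDegree n i j < rowWeight n j l + colWeight n l i := by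
  zify
  rw [cast_rowWeight hl, cast_colWeight hl (hij.trans hj), cast_quadricDegree hij.le hj]
  zify at hij hj hl
  have h1 : (l : ℤ) * (n + (j - i)) ≤ n * (2 * n) := by gcongr; linarith
  have h2 : (n : ℤ) ^ 2 * 1 ≤ n ^ 2 * (j - i) := by gcongr; linarith
  have h3 : (n : ℤ) ≤ n ^ 2 := by nlinarith
  nlinarith [sq_nonneg ((n : ℤ) - (j - i)), sq_nonneg (l : ℤ)]

theorem quadricDegree_lt_swap_of_le (hij : i ≤ j) (hj : j < n) (hl : l < n) (hi : i < n - 1) :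
    quadricDegree n i j < colWeight n i l + rowWeight n l j := by
  zify
  rw [cast_rowWeight hj, cast_colWeight (hij.trans_lt hj) hl, cast_quadricDegree hij hj]
  have hi' : (i : ℤ) < n - 1 := by omega
  rcases hij.eq_or_lt with rfl | hij
  · have : 0 < ((n : ℤ) - i) * (n - i - 1) := by apply mul_pos <;> linarith
    linarith
  · zify at hij hj hl
    have h1 : (i : ℤ) * (n - l) ≤ n * n := by gcongr <;> linarith
    have h4 : (j : ℤ) * l ≤ n * n := by gcongr
    have h2 : (n : ℤ) ^ 2 * 1 ≤ n ^ 2 * (j - i) := by gcongr; linarith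
    have h3 : (n : ℤ) ≤ n ^ 2 := by nlinarith
    nlinarith [sq_nonneg ((n : ℤ) - (j - i)), sq_nonneg (j : ℤ)]

theorem quadricDegree_lt_swap_of_ge (hij : i ≤ j) (hj : j < n) (hl : l < n) (hi : i < n - 1) :
    quadricDegree n i j < colWeight n j l + rowWeight n l i := by
  rcases hij.eq_or_lt with rfl | hij
  · exact quadricDegree_lt_swap_of_le le_rfl hj hl hi
  zify
  rw [cast_rowWeight (hij.trans hj), cast_colWeight hj hl, cast_quadricDegree hij.le hj]
  zify at hij hj hl
  have h1 : (j : ℤ) * (n - l) ≤ n * n := by gcongr; linarith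
  have h4 : (i : ℤ) * l ≤ n * n := by gcongr; linarith
  have h2 : (n : ℤ) ^ 2 * 1 ≤ n ^ 2 * (j - i) := by gcongr; linarith
  have h3 : (n : ℤ) ≤ n ^ 2 := by nlinarith
  nlinarith [sq_nonneg ((n : ℤ) - (j - i)), sq_nonneg (i : ℤ)]

theorem quadricDegree_lt (hij : i ≤ j) (hj : j < n) :
    quadricDegree n i j < 3 * baseWeight n := by
  zify
  rw [cast_quadricDegree hij hj, baseWeight]
  push_cast
  have h1 : (n : ℤ) ^ 2 * (n - (j - i)) ≤ n ^ 2 * n := by gcongr; linarith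
  nlinarith [sq_nonneg ((n : ℤ) - (j - i) - 1), sq_nonneg (n : ℤ)]

end QuadricWeights

section SymbolSums

variable {σ k ι : Type*} [CommRing k] {w : σ → ℕ} {d : ℕ}

theorem IsWeightSymbol.add_of_mem {a b : MvPowerSeries σ k} {g : MvPolynomial σ k}
    (ha : IsWeightSymbol w d a g) (hb : b ∈ weightIdeal w k (d + 1)) :
    IsWeightSymbol w d (a + b) g := by
  simpa using ha.add (.of_mem_succ hb)

theorem IsWeightSymbol.sum_of_eq [Fintype ι] [DecidableEq ι] {f : ι → MvPowerSeries σ k}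
    {g : MvPolynomial σ k} (a : ι) (ha : IsWeightSymbol w d (f a) g)
    (hf : ∀ i, i ≠ a → f i ∈ weightIdeal w k (d + 1)) : IsWeightSymbol w d (∑ i, f i) g := by
  rw [← Finset.add_sum_erase _ _ (Finset.mem_univ a)]
  exact ha.add_of_mem (sum_mem fun i hi => hf i (Finset.ne_of_mem_erase hi))

theorem IsWeightSymbol.sum_of_eq_or_eq [Fintype ι] [DecidableEq ι] {f : ι → MvPowerSeries σ k}
    {g h : MvPolynomial σ k} (a b : ι) (hab : a ≠ b) (ha : IsWeightSymbol w d (f a) g)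
    (hb : IsWeightSymbol w d (f b) h)
    (hf : ∀ i, i ≠ a → i ≠ b → f i ∈ weightIdeal w k (d + 1)) :
    IsWeightSymbol w d (∑ i, f i) (g + h) := by
  rw [← Finset.add_sum_erase _ _ (Finset.mem_univ a),
    ← Finset.add_sum_erase _ _ (Finset.mem_erase.2 ⟨hab.symm, Finset.mem_univ b⟩), ← add_assoc]
  refine (ha.add hb).add_of_mem (sum_mem fun i hi => ?_)
  rw [Finset.mem_erase, Finset.mem_erase] at hi
  exact hf i hi.2.1 hi.1

end SymbolSums

section QuadricSymbols

variable {m n : ℕ}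

/-- The index of the entry `(i, l)` of one of the first four matrices of variables. -/
def quadricVar (hm : 1 ≤ m) (a : Fin 4) (i l : Fin n) : Fin (2 * m + 2) × Fin n × Fin n :=
  (Fin.castLE (by omega) a, i, l)

theorem quadricVar_inj (hm : 1 ≤ m) {a a' : Fin 4} {i l i' l' : Fin n} :
    quadricVar hm a i l = quadricVar hm a' i' l' ↔ a = a' ∧ i = i' ∧ l = l' := by
  rw [quadricVar, quadricVar, Prod.mk.injEq, Prod.mk.injEq, (Fin.castLE_injective _).eq_iff]

/-- The weights of the variables; the entry `(z, z)` of the first matrix is distinguished. -/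
def quadricWeight (m : ℕ) (z : Fin n) (v : Fin (2 * m + 2) × Fin n × Fin n) : ℕ :=
  if v = (⟨0, by omega⟩, z, z) then baseWeight n
  else if v.1.1 = 0 then rowWeight n v.2.1 v.2.2
  else if v.1.1 = 1 then colWeight n v.2.1 v.2.2
  else if v.1.1 = 2 then colWeight n v.2.2 v.2.1
  else if v.1.1 = 3 then rowWeight n v.2.2 v.2.1
  else 2 * baseWeight n

/-- The inner index of the product of variables that occurs only in the leading term `x`. -/
def newIndex (x : Fin n × Fin n) : Fin n :=
  ⟨n - 1 - ((x.1 - x.2 : ℕ) + (x.2 - x.1)), by have := x.1.isLt; omega⟩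

/-- The inner index of the other product of variables in the leading term `x`. -/
def oldIndex (x : Fin n × Fin n) : Fin n :=
  ⟨n - max ((x.1 - x.2 : ℕ) + (x.2 - x.1)) 1, by have := x.1.isLt; omega⟩

/-- The left variable of the first product in the leading term `x`. -/
def newLeft (hm : 1 ≤ m) (x : Fin n × Fin n) : Fin (2 * m + 2) × Fin n × Fin n :=
  quadricVar hm (if x.1 < x.2 then 0 else 2) x.1 (newIndex x)

/-- The right variable of the first product in the leading term `x`. -/
def newRight (hm : 1 ≤ m) (x : Fin n × Fin n) : Fin (2 * m + 2) × Fin n × Fin n :=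
  quadricVar hm (if x.1 < x.2 then 1 else 3) (newIndex x) x.2

/-- The left variable of the second product in the leading term `x`. -/
def oldLeft (hm : 1 ≤ m) (x : Fin n × Fin n) : Fin (2 * m + 2) × Fin n × Fin n :=
  quadricVar hm (if x.1 ≤ x.2 then 0 else 2) x.1 (oldIndex x)

/-- The right variable of the second product in the leading term `x`. -/
def oldRight (hm : 1 ≤ m) (x : Fin n × Fin n) : Fin (2 * m + 2) × Fin n × Fin n :=
  quadricVar hm (if x.1 ≤ x.2 then 1 else 3) (oldIndex x) x.2

theorem exists_primeChain_leadingTerms {k : Type*} [Field k] (hm : 1 ≤ m) (z : Fin n)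
    (hz : z.1 = n - 1) {c : k} (hc : c ≠ 0) :
    ∃ l : List {x : Fin n × Fin n // x ≠ (z, z)}, (∀ x, x ∈ l) ∧ PrimeChain
      (l.map (fun x => (MvPolynomial.X (newLeft hm x.1) * MvPolynomial.X (newRight hm x.1) +
        MvPolynomial.X (oldLeft hm x.1) * MvPolynomial.X (oldRight hm x.1) :
          MvPolynomial (Fin (2 * m + 2) × Fin n × Fin n) k)) ++
        [MvPolynomial.C c * MvPolynomial.X (quadricVar hm 0 z z)]) := by
  have hne : ∀ x : {x : Fin n × Fin n // x ≠ (z, z)}, ¬ (x.1.1.1 = n - 1 ∧ x.1.2.1 = n - 1) := by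
    rintro ⟨⟨i, j⟩, h⟩ ⟨hi, hj⟩
    exact h (Prod.ext (Fin.ext (hi.trans hz.symm)) (Fin.ext (hj.trans hz.symm)))
  have hlt := fun x : {x : Fin n × Fin n // x ≠ (z, z)} => And.intro x.1.1.isLt x.1.2.isLt
  refine exists_primeChain_quadrics _ _ _ _ _
    (fun x => (x.1.1 - x.1.2 : ℕ) + (x.1.2 - x.1.1)) hc ?_ ?_ ?_ ?_ ?_ ?_ ?_ ?_
  · intro x
    rw [newLeft, newRight, Ne, quadricVar_inj]
    split_ifs <;> simp
  · intro x
    rw [oldLeft, oldRight, Ne, quadricVar_inj]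
    split_ifs <;> simp
  · intro x
    have := hne x
    rw [newLeft, Ne, quadricVar_inj]
    split_ifs with h
    · have := hlt x
      simp only [Fin.ext_iff, Fin.lt_def] at *
      omega
    · simp
  · intro x
    rw [newRight, Ne, quadricVar_inj]
    split_ifs <;> simp
  · intro x
    have := hne x
    rw [oldLeft, Ne, quadricVar_inj]
    split_ifs with h
    · have := hlt x
      simp only [Fin.ext_iff, Fin.le_def] at *
      omega
    · simp
  · intro x
    rw [oldRight, Ne, quadricVar_inj]
    split_ifs <;> simp
  · intro x
    have := hlt x
    simp only [newLeft, newRight, oldLeft, oldRight, Ne, quadricVar_inj, newIndex, oldIndex]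
    split_ifs <;>
      simp only [Fin.reduceEq, Fin.isValue, false_and, true_and, not_false_eq_true, and_true] <;>
      simp only [Fin.ext_iff, Fin.lt_def, Fin.le_def] at * <;> omega
  · intro x y hyx hlev
    have hx := hlt x
    have hy := hlt y
    rw [Ne, Subtype.ext_iff, Prod.ext_iff] at hyx
    simp only [newLeft, newRight, oldLeft, oldRight, Ne, quadricVar_inj, newIndex, oldIndex]
    split_ifs <;>
      simp only [Fin.reduceEq, Fin.isValue, false_and, true_and, not_false_eq_true, and_true] <;>
      simp only [Fin.ext_iff, Fin.lt_def, Fin.le_def] at * <;> omega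

theorem quadricWeight_zero (hm : 1 ≤ m) {z i l : Fin n} (h : (i, l) ≠ (z, z)) :
    quadricWeight m z (quadricVar hm 0 i l) = rowWeight n i l := by
  rw [quadricWeight, if_neg fun h' => h (Prod.ext_iff.1 h').2]
  simp [quadricVar]

theorem quadricWeight_one (hm : 1 ≤ m) (z l j : Fin n) :
    quadricWeight m z (quadricVar hm 1 l j) = colWeight n l j := by
  simp [quadricWeight, quadricVar, Fin.ext_iff]

theorem quadricWeight_two (hm : 1 ≤ m) (z i l : Fin n) :
    quadricWeight m z (quadricVar hm 2 i l) = colWeight n l i := by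
  simp [quadricWeight, quadricVar, Fin.ext_iff]

theorem quadricWeight_three (hm : 1 ≤ m) (z l j : Fin n) :
    quadricWeight m z (quadricVar hm 3 l j) = rowWeight n j l := by
  simp [quadricWeight, quadricVar, Fin.ext_iff]

theorem isWeightSymbol_bracket {k : Type*} [CommRing k] (hm : 1 ≤ m) {z : Fin n}
    (hz : z.1 = n - 1)
    {A B C D : Matrix (Fin n) (Fin n) (MvPowerSeries (Fin (2 * m + 2) × Fin n × Fin n) k)}
    (hA : ∀ i l, (i, l) ≠ (z, z) → A i l = MvPowerSeries.X (quadricVar hm 0 i l))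
    (hAz : A z z = 0) (hB : ∀ i l, B i l = MvPowerSeries.X (quadricVar hm 1 i l))
    (hC : ∀ i l, C i l = MvPowerSeries.X (quadricVar hm 2 i l))
    (hD : ∀ i l, D i l = MvPowerSeries.X (quadricVar hm 3 i l))
    (x : Fin n × Fin n) (hx : x ≠ (z, z)) :
    IsWeightSymbol (quadricWeight m z) (quadricDegree n x.1 x.2)
      ((A * B - B * A + (C * D - D * C)) x.1 x.2)
      (MvPolynomial.X (newLeft hm x) * MvPolynomial.X (newRight hm x) +
        MvPolynomial.X (oldLeft hm x) * MvPolynomial.X (oldRight hm x)) := by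
  have hAmem : ∀ i l : Fin n, A i l ∈ weightIdeal (quadricWeight m z) k (rowWeight n i l) := by
    intro i l
    by_cases h : (i, l) = (z, z)
    · obtain ⟨h1, h2⟩ := Prod.mk.inj h
      rw [show A i l = 0 by rw [h1, h2, hAz]]
      exact zero_mem _
    · rw [hA i l h, ← quadricWeight_zero hm h]
      exact X_mem_weightIdeal _ _
  have hAB : ∀ {N : ℕ} (i l j : Fin n), N ≤ rowWeight n i l + colWeight n l j →
      A i l * B l j ∈ weightIdeal (quadricWeight m z) k N := fun i l j h =>
    weightIdeal_mono _ h (mul_mem_weightIdeal _ (hAmem i l) (by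
      rw [hB, ← quadricWeight_one hm z]; exact X_mem_weightIdeal _ _))
  have hBA : ∀ {N : ℕ} (i l j : Fin n), N ≤ colWeight n i l + rowWeight n l j →
      B i l * A l j ∈ weightIdeal (quadricWeight m z) k N := fun i l j h =>
    weightIdeal_mono _ h (mul_mem_weightIdeal _ (by
      rw [hB, ← quadricWeight_one hm z]; exact X_mem_weightIdeal _ _) (hAmem l j))
  have hCD : ∀ {N : ℕ} (i l j : Fin n), N ≤ rowWeight n j l + colWeight n l i →
      C i l * D l j ∈ weightIdeal (quadricWeight m z) k N := fun i l j h => by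
    rw [add_comm, ← quadricWeight_two hm z, ← quadricWeight_three hm z] at h
    rw [hC, hD]
    exact weightIdeal_mono _ h (mul_mem_weightIdeal _ (X_mem_weightIdeal _ _)
      (X_mem_weightIdeal _ _))
  have hDC : ∀ {N : ℕ} (i l j : Fin n), N ≤ colWeight n j l + rowWeight n l i →
      D i l * C l j ∈ weightIdeal (quadricWeight m z) k N := fun i l j h => by
    rw [add_comm, ← quadricWeight_two hm z, ← quadricWeight_three hm z] at h
    rw [hC, hD]
    exact weightIdeal_mono _ h (mul_mem_weightIdeal _ (X_mem_weightIdeal _ _)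
      (X_mem_weightIdeal _ _))
  have hABs : ∀ {N : ℕ} (i l j : Fin n), (i, l) ≠ (z, z) →
      rowWeight n i l + colWeight n l j = N → IsWeightSymbol (quadricWeight m z) N (A i l * B l j)
        (MvPolynomial.X (quadricVar hm 0 i l) * MvPolynomial.X (quadricVar hm 1 l j)) := by
    intro N i l j hil h
    rw [hA i l hil, hB, ← h, ← quadricWeight_zero hm hil, ← quadricWeight_one hm z]
    exact isWeightSymbol_X _ |>.mul (isWeightSymbol_X _)
  have hCDs : ∀ {N : ℕ} (i l j : Fin n), rowWeight n j l + colWeight n l i = N →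
      IsWeightSymbol (quadricWeight m z) N (C i l * D l j)
        (MvPolynomial.X (quadricVar hm 2 i l) * MvPolynomial.X (quadricVar hm 3 l j)) := by
    intro N i l j h
    rw [hC, hD, ← h, add_comm (rowWeight n j l), ← quadricWeight_two hm z,
      ← quadricWeight_three hm z]
    exact isWeightSymbol_X _ |>.mul (isWeightSymbol_X _)
  obtain ⟨i, j⟩ := x
  dsimp only
  have hi := i.isLt
  have hj := j.isLt
  have hne : ¬ (i.1 = n - 1 ∧ j.1 = n - 1) := fun ⟨hi, hj⟩ =>
    hx (Prod.ext (Fin.ext (hi.trans hz.symm)) (Fin.ext (hj.trans hz.symm)))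
  have hbr : (A * B - B * A + (C * D - D * C)) i j =
      (∑ l, A i l * B l j + ∑ l, C i l * D l j) +
        (-∑ l, B i l * A l j - ∑ l, D i l * C l j) := by
    rw [Matrix.add_apply, Matrix.sub_apply, Matrix.sub_apply, Matrix.mul_apply, Matrix.mul_apply,
      Matrix.mul_apply, Matrix.mul_apply]
    ring
  have hneg : -∑ l, B i l * A l j - ∑ l, D i l * C l j ∈
      weightIdeal (quadricWeight m z) k (quadricDegree n i j + 1) := by
    refine sub_mem (neg_mem (sum_mem fun l _ => hBA i l j ?_)) (sum_mem fun l _ => hDC i l j ?_)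
    · rcases le_total i.1 j.1 with hij | hij
      · exact quadricDegree_lt_swap_of_le hij hj l.isLt (by omega)
      · rw [quadricDegree_comm]
        exact quadricDegree_lt_swap_of_ge hij hi l.isLt (by omega)
    · rcases le_total i.1 j.1 with hij | hij
      · exact quadricDegree_lt_swap_of_ge hij hj l.isLt (by omega)
      · rw [quadricDegree_comm]
        exact quadricDegree_lt_swap_of_le hij hi l.isLt (by omega)
  rw [hbr]
  refine IsWeightSymbol.add_of_mem ?_ hneg
  rw [newLeft, newRight, oldLeft, oldRight]
  dsimp only
  rcases lt_trichotomy i j with hij | hij | hij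
  · rw [if_pos hij, if_pos hij, if_pos hij.le, if_pos hij.le]
    have hij' : i.1 < j.1 := hij
    refine IsWeightSymbol.add_of_mem (IsWeightSymbol.sum_of_eq_or_eq (newIndex (i, j))
      (oldIndex (i, j)) ?_ (hABs _ _ _ ?_ ?_) (hABs _ _ _ ?_ ?_) fun l h1 h2 => hAB _ _ _ ?_)
      (sum_mem fun l _ => hCD _ _ _ ?_)
    · simp only [newIndex, oldIndex, Ne, Fin.ext_iff]
      omega
    · rintro h
      have := Fin.ext_iff.1 (Prod.ext_iff.1 h).1
      dsimp only at this
      omega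
    · exact rowWeight_add_colWeight hij'.le hj (Fin.isLt _)
        (Or.inl (by simp only [newIndex]; omega))
    · rintro h
      have := Fin.ext_iff.1 (Prod.ext_iff.1 h).1
      dsimp only at this
      omega
    · exact rowWeight_add_colWeight hij'.le hj (Fin.isLt _)
        (Or.inr (by simp only [oldIndex]; omega))
    · simp only [newIndex, oldIndex, Ne, Fin.ext_iff] at h1 h2
      exact quadricDegree_lt_of_ne hij'.le hj l.isLt (by omega) (by omega)
    · exact quadricDegree_lt_of_lt hij' hj l.isLt
  · subst hij
    rw [if_neg (lt_irrefl i), if_neg (lt_irrefl i), if_pos le_rfl, if_pos le_rfl,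
      add_comm (MvPolynomial.X _ * MvPolynomial.X _)]
    refine IsWeightSymbol.add
      (IsWeightSymbol.sum_of_eq (oldIndex (i, i)) (hABs _ _ _ ?_ ?_) fun l h => hAB _ _ _ ?_)
      (IsWeightSymbol.sum_of_eq (newIndex (i, i)) (hCDs _ _ _ ?_) fun l h => hCD _ _ _ ?_)
    · rintro h
      have := Fin.ext_iff.1 (Prod.ext_iff.1 h).1
      dsimp only at this
      omega
    · exact rowWeight_add_colWeight le_rfl hj (Fin.isLt _)
        (Or.inr (by simp only [oldIndex]; omega))
    · simp only [oldIndex, Ne, Fin.ext_iff] at h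
      exact quadricDegree_lt_of_ne le_rfl hj l.isLt (by omega) (by omega)
    · exact rowWeight_add_colWeight le_rfl hj (Fin.isLt _)
        (Or.inl (by simp only [newIndex]; omega))
    · simp only [newIndex, Ne, Fin.ext_iff] at h
      exact quadricDegree_lt_of_ne le_rfl hj l.isLt (by omega) (by omega)
  · have hij' : j.1 < i.1 := hij
    rw [if_neg hij.not_gt, if_neg hij.not_gt, if_neg hij.not_ge, if_neg hij.not_ge,
      quadricDegree_comm, add_comm (∑ l, A i l * B l j)]
    refine IsWeightSymbol.add_of_mem (IsWeightSymbol.sum_of_eq_or_eq (newIndex (i, j))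
      (oldIndex (i, j)) ?_ (hCDs _ _ _ ?_) (hCDs _ _ _ ?_) fun l h1 h2 => hCD _ _ _ ?_)
      (sum_mem fun l _ => hAB _ _ _ ?_)
    · simp only [newIndex, oldIndex, Ne, Fin.ext_iff]
      omega
    · exact rowWeight_add_colWeight hij'.le hi (Fin.isLt _)
        (Or.inl (by simp only [newIndex]; omega))
    · exact rowWeight_add_colWeight hij'.le hi (Fin.isLt _)
        (Or.inr (by simp only [oldIndex]; omega))
    · simp only [newIndex, oldIndex, Ne, Fin.ext_iff] at h1 h2
      exact quadricDegree_lt_of_ne hij'.le hi l.isLt (by omega) (by omega)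
    · exact quadricDegree_lt_of_lt hij' hi l.isLt

end QuadricSymbols

theorem PrimeChain.of_map_equiv {R S : Type*} [CommRing R] [CommRing S] (e : R ≃+* S) {l : List R}
    (h : PrimeChain (l.map e)) : PrimeChain l := by
  have key : ∀ l : List R, (Ideal.ofList (l.map e)).IsPrime → (Ideal.ofList l).IsPrime := by
    intro l hl
    have h1 := hl.comap (e : R →+* S)
    have h2 := Ideal.map_ofList (e : R →+* S) l
    rw [RingEquiv.coe_toRingHom] at h2
    rwa [← h2, Ideal.comap_map_of_bijective (e : R →+* S) e.bijective] at h1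
  induction l with
  | nil => simpa [PrimeChain] using key [] (by simpa [PrimeChain] using h)
  | cons f l ih =>
    refine ⟨ih h.1, fun hf => h.2.1 ?_, key (f :: l) h.2.2⟩
    have h2 := Ideal.map_ofList (e : R →+* S) l
    rw [RingEquiv.coe_toRingHom] at h2
    rw [← h2]
    exact Ideal.mem_map_of_mem (e : R →+* S) hf

open MvPowerSeries in
theorem MvPowerSeries.exists_shear {k σ : Type*} [CommRing k] [Finite σ] (t : σ) (s : Set σ)
    (hts : t ∉ s) : ∃ θ : MvPowerSeries σ k ≃+* MvPowerSeries σ k,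
      (∀ i ∈ s, θ (X i) = X i + X t) ∧ (∀ i ∉ s, θ (X i) = X i) := by
  classical
  have hsubst : ∀ c : k, HasSubst (fun i => X i + if i ∈ s then C c * X t else 0) := fun c =>
    hasSubst_of_constantCoeff_zero fun i => by split_ifs <;> simp
  have hcomp : ∀ c c' : k, c + c' = 0 → ∀ f,
      substAlgHom (R := k) (hsubst c') (substAlgHom (R := k) (hsubst c) f) = f := by
    intro c c' hc f
    rw [coe_substAlgHom, coe_substAlgHom, subst_comp_subst_apply (hsubst c) (hsubst c')]
    conv_rhs => rw [show f = subst (X : σ → MvPowerSeries σ k) f by rw [subst_self]; rfl]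
    congr 1
    funext i
    rw [← coe_substAlgHom (R := k) (hsubst c'), map_add, substAlgHom_X]
    split_ifs with h
    · have hC : C c' + C c = (0 : MvPowerSeries σ k) := by rw [← map_add, add_comm, hc, map_zero]
      rw [map_mul, substAlgHom_X, if_neg hts, add_zero,
        show (C c : MvPowerSeries σ k) = algebraMap k _ c from rfl, AlgHom.commutes,
        show algebraMap k (MvPowerSeries σ k) c = C c from rfl]
      linear_combination X t * hC
    · rw [map_zero, add_zero, add_zero]
  refine ⟨(AlgEquiv.ofAlgHom (substAlgHom (R := k) (hsubst 1)) (substAlgHom (R := k) (hsubst (-1)))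
    ?_ ?_).toRingEquiv, ?_, ?_⟩
  · exact AlgHom.ext fun f => hcomp (-1) 1 (by ring) f
  · exact AlgHom.ext fun f => hcomp 1 (-1) (by ring) f
  · intro i hi
    refine (substAlgHom_X (R := k) (hsubst 1) i).trans ?_
    rw [if_pos hi, map_one, one_mul]
  · intro i hi
    refine (substAlgHom_X (R := k) (hsubst 1) i).trans ?_
    rw [if_neg hi, add_zero]

theorem isWeightSymbol_det {σ k : Type*} [CommRing k] {w : σ → ℕ} {n : ℕ} (v : σ) (hv : w v ≠ 0)
    {A : Matrix (Fin n) (Fin n) (MvPowerSeries σ k)}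
    (hA : A ∈ (weightIdeal w k (w v + 1)).matrix (Fin n)) :
    IsWeightSymbol w (w v) (((1 + MvPowerSeries.X v : MvPowerSeries σ k) •
      (1 : Matrix (Fin n) (Fin n) (MvPowerSeries σ k)) + A).det - 1)
      (MvPolynomial.C (n : k) * MvPolynomial.X v) := by
  set t : MvPowerSeries σ k := MvPowerSeries.X v with ht
  have h1 : ((1 + t) • (1 : Matrix (Fin n) (Fin n) (MvPowerSeries σ k)) + A).det - (1 + t) ^ n ∈
      weightIdeal w k (w v + 1) := by
    rw [← Ideal.Quotient.eq, RingHom.map_det, map_add]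
    have : (Ideal.Quotient.mk (weightIdeal w k (w v + 1))).mapMatrix A = 0 := by
      ext i j
      exact Ideal.Quotient.eq_zero_iff_mem.2 (hA i j)
    rw [this, add_zero, ← RingHom.map_det, Matrix.det_smul, Matrix.det_one, mul_one,
      Fintype.card_fin]
  obtain ⟨c, hc⟩ := Polynomial.powAddExpansion 1 t n
  have h2 : c * t ^ 2 ∈ weightIdeal w k (w v + 1) := by
    refine Ideal.mul_mem_left _ _ ?_
    rw [pow_two]
    exact weightIdeal_mono w (by omega)
      (mul_mem_weightIdeal w (X_mem_weightIdeal w v) (X_mem_weightIdeal w v))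
  have h3 : ((1 + t) • (1 : Matrix (Fin n) (Fin n) (MvPowerSeries σ k)) + A).det - 1 =
      MvPowerSeries.C (n : k) * t +
      ((((1 + t) • (1 : Matrix (Fin n) (Fin n) (MvPowerSeries σ k)) + A).det - (1 + t) ^ n) +
        c * t ^ 2) := by
    rw [hc, map_natCast]
    ring
  rw [h3]
  have h4 := (isWeightSymbol_C (w := w) (n : k)).mul (isWeightSymbol_X v)
  rw [zero_add] at h4
  exact h4.add_of_mem (add_mem h1 h2)

theorem isUnit_det_Xt {A : Type*} [CommRing A] (N n : ℕ) (i : Fin N) :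
    IsUnit (Xt (A := A) N n i).det := by
  rw [MvPowerSeries.isUnit_iff_constantCoeff, RingHom.map_det]
  have : MvPowerSeries.constantCoeff.mapMatrix (Xt (A := A) N n i) = 1 := by
    rw [Xt, map_add, map_one, add_eq_left]
    ext a b
    exact MvPowerSeries.constantCoeff_X _
  rw [this, Matrix.det_one]
  exact isUnit_one

theorem exists_primeChain_relMatrix_of_field {k : Type*} [Field k] {p : ℕ} [Fact p.Prime]
    [CharP k p] {s m n : ℕ} (hs : 3 ≤ p ^ s) (hm : 1 ≤ m) (hn : 2 ≤ n) (hpn : n < p) (z : Fin n)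
    (hz : z.1 = n - 1) :
    ∃ l : List {x : Fin n × Fin n // x ≠ (z, z)}, (∀ x, x ∈ l) ∧ PrimeChain
      (l.map (fun x => (relMatrix (A := k) (p ^ s) m n - 1) x.1.1 x.1.2) ++
        [(Xt (A := k) (2 * m + 2) n ⟨0, by omega⟩).det - 1]) := by
  have hc : (n : k) ≠ 0 := fun h =>
    absurd (Nat.le_of_dvd (by omega) ((CharP.cast_eq_zero_iff k p n).1 h)) (by omega)
  obtain ⟨l, hl, hch⟩ := exists_primeChain_leadingTerms hm z hz hc
  refine ⟨l, hl, ?_⟩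
  set t := quadricVar hm 0 z z with ht
  obtain ⟨θ, hθ, hθ'⟩ :=
    MvPowerSeries.exists_shear (k := k) t {v | ∃ i ≠ z, v = quadricVar hm 0 i i}
    (by rintro ⟨i, hi, h⟩; exact hi ((quadricVar_inj hm).1 h).2.1.symm)
  set w := quadricWeight m z with hw
  have hwt : w t = baseWeight n := by rw [hw, quadricWeight, if_pos]; rfl
  have hN : 3 ≤ baseWeight n := by rw [baseWeight]; omega
  have hw1 : ∀ v, v ≠ t → baseWeight n + 1 ≤ w v := by
    intro v hv
    rw [hw, quadricWeight, if_neg (show ¬ v = (⟨0, by omega⟩, z, z) from hv)]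
    split_ifs <;> first | omega | (rw [rowWeight]; omega) | (rw [colWeight]; omega)
  have hw0 : ∀ v, baseWeight n ≤ w v := fun v => by
    by_cases hv : v = t
    · rw [hv, hwt]
    · exact (Nat.le_succ _).trans (hw1 v hv)
  have hw4 : ∀ v, 4 ≤ v.1.1 → w v = 2 * baseWeight n := by
    intro v hv
    rw [hw, quadricWeight, if_neg, if_neg, if_neg, if_neg, if_neg] <;> first | omega | skip
    rintro rfl
    simp at hv
  let B : Fin (2 * m + 2) → Matrix (Fin n) (Fin n)
      (MvPowerSeries (Fin (2 * m + 2) × Fin n × Fin n) k) := fun a =>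
    Matrix.of fun i j => if (a, i, j) = t then 0 else MvPowerSeries.X (a, i, j)
  have hBne : ∀ a i j, (a, i, j) ≠ t → B a i j = MvPowerSeries.X (a, i, j) := fun a i j h => by
    change (if (a, i, j) = t then 0 else MvPowerSeries.X (a, i, j)) = _
    rw [if_neg h]
  have hBmem : ∀ {N : ℕ} a, (∀ i j, (a, i, j) ≠ t → N ≤ w (a, i, j)) →
      B a ∈ (weightIdeal w k N).matrix (Fin n) := by
    intro N a h i j
    change (if (a, i, j) = t then 0 else MvPowerSeries.X (a, i, j)) ∈ _
    split_ifs with hv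
    · exact zero_mem _
    · exact weightIdeal_mono w (h i j hv) (X_mem_weightIdeal w _)
  let U : Fin (2 * m + 2) → Matrix (Fin n) (Fin n)
      (MvPowerSeries (Fin (2 * m + 2) × Fin n × Fin n) k) := fun a =>
    (RingHomClass.toRingHom θ).mapMatrix (Xt (A := k) (2 * m + 2) n a)
  have hU0 : U ⟨0, by omega⟩ =
      (1 + MvPowerSeries.X t : MvPowerSeries (Fin (2 * m + 2) × Fin n × Fin n) k) •
      (1 : Matrix (Fin n) (Fin n) (MvPowerSeries (Fin (2 * m + 2) × Fin n × Fin n) k)) +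
      B ⟨0, by omega⟩ := by
    ext1 i j
    change θ ((1 : Matrix _ _ _) i j + MvPowerSeries.X (quadricVar hm 0 i j)) =
      (1 + MvPowerSeries.X t) * (1 : Matrix _ _ _) i j +
        (if quadricVar hm 0 i j = t then 0 else MvPowerSeries.X (quadricVar hm 0 i j))
    by_cases hij : i = j
    · subst hij
      rw [Matrix.one_apply_eq, map_add, map_one]
      by_cases hi : i = z
      · subst hi
        rw [if_pos rfl, hθ']
        · ring
        · rintro ⟨i', hi', h⟩; exact hi' ((quadricVar_inj hm).1 h).2.1.symm
      · rw [if_neg (fun h => hi ((quadricVar_inj hm).1 h).2.1), hθ _ ⟨i, hi, rfl⟩]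
        ring
    · rw [Matrix.one_apply_ne hij, zero_add, if_neg, hθ']
      · ring
      · rintro ⟨i', -, h⟩
        rw [quadricVar_inj] at h
        exact hij (h.2.1.trans h.2.2.symm)
      · intro h
        rw [quadricVar_inj] at h
        exact hij (h.2.1.trans h.2.2.symm)
  have hU : ∀ a : Fin (2 * m + 2), a.1 ≠ 0 → U a = 1 + B a := by
    intro a ha
    have hne : ∀ i j i' j' : Fin n, (a, i, j) ≠ quadricVar hm 0 i' j' := fun i j i' j' h =>
      ha (Fin.ext_iff.1 (Prod.ext_iff.1 h).1)
    ext1 i j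
    change θ ((1 : Matrix _ _ _) i j + MvPowerSeries.X (a, i, j)) = (1 : Matrix _ _ _) i j +
        (if (a, i, j) = t then 0 else MvPowerSeries.X (a, i, j))
    rw [if_neg (hne _ _ _ _), map_add, hθ' _ (by rintro ⟨i', -, h⟩; exact hne _ _ _ _ h)]
    congr 1
    rw [Matrix.one_apply]
    split_ifs <;> simp
  have hdet : ∀ a, IsUnit (U a).det := fun a => by
    have := (isUnit_det_Xt (A := k) (2 * m + 2) n a).map (RingHomClass.toRingHom θ)
    rwa [RingHom.map_det] at this
  have hrel := relWord_sub_mem w (s := s) (N := baseWeight n) (D := 3 * baseWeight n)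
    hm hs (by omega)
    le_rfl (by omega) (MvPowerSeries.X t) (hwt ▸ X_mem_weightIdeal w t) B
    (fun a => hBmem a fun i j _ => hw0 _) (fun a ha => hBmem a fun i j _ => (hw4 _ ha).ge) U hU0 hU
    hdet
  have hsymb : ∀ x : {x : Fin n × Fin n // x ≠ (z, z)},
      IsWeightSymbol w (quadricDegree n x.1.1 x.1.2) ((relWord (p ^ s) m U - 1) x.1.1 x.1.2)
      (MvPolynomial.X (newLeft hm x.1) * MvPolynomial.X (newRight hm x.1) +
        MvPolynomial.X (oldLeft hm x.1) * MvPolynomial.X (oldRight hm x.1)) := by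
    intro x
    have hne : ∀ (a : Fin 4) i j, a ≠ 0 → quadricVar hm a i j ≠ t := fun a i j ha h =>
      ha ((quadricVar_inj hm).1 h).1
    have h1 := isWeightSymbol_bracket (k := k) hm hz
      (A := B ⟨0, by omega⟩) (B := B ⟨1, by omega⟩) (C := B ⟨2, by omega⟩) (D := B ⟨3, by omega⟩)
      (fun i l h => hBne _ _ _ fun h' => h (Prod.ext_iff.1 h').2) (if_pos rfl)
      (fun i l => hBne _ _ _ (hne 1 i l (by decide)))
      (fun i l => hBne _ _ _ (hne 2 i l (by decide)))
      (fun i l => hBne _ _ _ (hne 3 i l (by decide))) x.1 x.2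
    have hd : quadricDegree n x.1.1 x.1.2 + 1 ≤ 3 * baseWeight n := by
      rcases le_total x.1.1.1 x.1.2.1 with h | h
      · exact quadricDegree_lt h x.1.2.isLt
      · rw [quadricDegree_comm]
        exact quadricDegree_lt h x.1.1.isLt
    have h2 := h1.add_of_mem (weightIdeal_mono w hd (hrel x.1.1 x.1.2))
    rwa [Matrix.sub_apply _ _ x.1.1 x.1.2, add_sub_cancel] at h2
  have hsymb' : IsWeightSymbol w (w t) ((U ⟨0, by omega⟩).det - 1)
      (MvPolynomial.C (n : k) * MvPolynomial.X t) := by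
    rw [hU0]
    exact isWeightSymbol_det t (by omega) (hBmem _ fun i j h => hwt ▸ hw1 _ h)
  refine PrimeChain.of_map_equiv θ ?_
  have := primeChain_of_weightSymbol (w := w) (k := k) (fun v => by have := hw0 v; omega)
    (ι := Option {x : Fin n × Fin n // x ≠ (z, z)})
    (fun o => o.elim ((U ⟨0, by omega⟩).det - 1)
      fun x => (relWord (p ^ s) m U - 1) x.1.1 x.1.2)
    (fun o => o.elim (MvPolynomial.C (n : k) * MvPolynomial.X t)
      fun x => MvPolynomial.X (newLeft hm x.1) * MvPolynomial.X (newRight hm x.1) +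
        MvPolynomial.X (oldLeft hm x.1) * MvPolynomial.X (oldRight hm x.1))
    (fun o => o.elim (w t) fun x => quadricDegree n x.1.1 x.1.2)
    (fun o => by cases o; exacts [hsymb', hsymb _])
    (l.map some ++ [none]) (by simpa [Function.comp_def] using hch)
  convert this using 1
  rw [List.map_append, List.map_append, List.map_map, List.map_map]
  congr 1
  · refine List.map_congr_left fun x _ => ?_
    have h1 := map_relWord (RingHomClass.toRingHom θ) (p ^ s) m (Xt (A := k) (2 * m + 2) n)
      (isUnit_det_Xt _ _)
    change θ ((relWord (p ^ s) m (Xt (A := k) (2 * m + 2) n) - 1) x.1.1 x.1.2) =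
      (relWord (p ^ s) m U - 1) x.1.1 x.1.2
    rw [← h1, Matrix.sub_apply, Matrix.sub_apply, map_sub]
    congr 1
    rw [Matrix.one_apply]
    split_ifs <;> simp
  · change [θ (_ - 1)] = [_ - 1]
    rw [map_sub, map_one]
    congr 2
    exact RingHom.map_det (RingHomClass.toRingHom θ) _

theorem isIntegral_iff_spectralNorm_le_one {p : ℕ} [Fact p.Prime] {L : Type*} [Field L]
    [Algebra ℚ_[p] L] [FiniteDimensional ℚ_[p] L] [Algebra ℤ_[p] L] [IsScalarTower ℤ_[p] ℚ_[p] L]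
    (x : L) : IsIntegral ℤ_[p] x ↔ spectralNorm ℚ_[p] L x ≤ 1 := by
  have hx : IsIntegral ℚ_[p] x := Algebra.IsIntegral.isIntegral x
  rw [spectralNorm, spectralValue_le_one_iff (minpoly.monic hx)]
  constructor
  · intro h n
    rw [minpoly.isIntegrallyClosed_eq_field_fractions' ℚ_[p] h, Polynomial.coeff_map]
    exact PadicInt.norm_le_one _
  · intro h
    have hl : minpoly ℚ_[p] x ∈ Polynomial.lifts (algebraMap ℤ_[p] ℚ_[p]) := by
      rw [Polynomial.lifts_iff_coeff_lifts]
      exact fun n => ⟨⟨_, h n⟩, rfl⟩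
    obtain ⟨f, hf, -, hfm⟩ := Polynomial.lifts_and_degree_eq_and_monic hl (minpoly.monic hx)
    refine ⟨f, hfm, ?_⟩
    have h1 := minpoly.aeval ℚ_[p] x
    rwa [← hf, Polynomial.aeval_map_algebraMap] at h1

theorem not_isUnit_ringOfIntegers_iff {p : ℕ} [Fact p.Prime] {L : Type*} [Field L]
    [Algebra ℚ_[p] L] [FiniteDimensional ℚ_[p] L] [Algebra ℤ_[p] L]
    [IsScalarTower ℤ_[p] ℚ_[p] L] (x : RingOfIntegers p L) :
    ¬ IsUnit x ↔ spectralNorm ℚ_[p] L x < 1 := by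
  have h1 : spectralNorm ℚ_[p] L (x : L) ≤ 1 := (isIntegral_iff_spectralNorm_le_one _).1 x.2
  have hmul := map_mul (spectralMulAlgNorm ℚ_[p] L)
  simp only [spectralMulAlgNorm_def] at hmul
  rw [h1.lt_iff_ne, not_iff_not]
  constructor
  · rintro ⟨u, rfl⟩
    have h2 : spectralNorm ℚ_[p] L ((↑u⁻¹ : RingOfIntegers p L) : L) ≤ 1 :=
      (isIntegral_iff_spectralNorm_le_one _).1 (↑u⁻¹ : RingOfIntegers p L).2
    have h3 := hmul (u : RingOfIntegers p L) (↑u⁻¹ : RingOfIntegers p L)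
    rw [← Subalgebra.coe_mul, Units.mul_inv, Subalgebra.coe_one, spectralNorm_one] at h3
    nlinarith [spectralNorm_nonneg (K := ℚ_[p]) ((u : RingOfIntegers p L) : L),
      spectralNorm_nonneg (K := ℚ_[p]) ((↑u⁻¹ : RingOfIntegers p L) : L)]
  · intro h
    have hx : (x : L) ≠ 0 := fun h0 => by
      rw [h0, spectralNorm_zero] at h
      exact zero_ne_one h
    have h3 := hmul x (x : L)⁻¹
    rw [mul_inv_cancel₀ hx, spectralNorm_one, h, one_mul] at h3
    have h4 : IsIntegral ℤ_[p] (x : L)⁻¹ := (isIntegral_iff_spectralNorm_le_one _).2 h3.ge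
    exact IsUnit.of_mul_eq_one (⟨_, h4⟩ : RingOfIntegers p L) (Subtype.ext (mul_inv_cancel₀ hx))

theorem isLocalRing_ringOfIntegers (p : ℕ) [Fact p.Prime] (L : Type*) [Field L]
    [Algebra ℚ_[p] L] [FiniteDimensional ℚ_[p] L] [Algebra ℤ_[p] L]
    [IsScalarTower ℤ_[p] ℚ_[p] L] : IsLocalRing (RingOfIntegers p L) := by
  refine .of_nonunits_add fun a b ha hb => ?_
  rw [mem_nonunits_iff, not_isUnit_ringOfIntegers_iff] at *
  exact (isNonarchimedean_spectralNorm (K := ℚ_[p]) (a : L) (b : L)).trans_lt (max_lt ha hb)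

theorem exists_uniformizer_ringOfIntegers (p : ℕ) [Fact p.Prime] (L : Type*) [Field L]
    [Algebra ℚ_[p] L] [FiniteDimensional ℚ_[p] L] [Algebra ℤ_[p] L]
    [IsScalarTower ℤ_[p] ℚ_[p] L] :
    IsDedekindDomain (RingOfIntegers p L) ∧ (p : RingOfIntegers p L) ≠ 0 ∧
    ∃ _ : IsLocalRing (RingOfIntegers p L), 
      CharP (IsLocalRing.ResidueField (RingOfIntegers p L)) p ∧ ∃ ϖ : RingOfIntegers p L, ϖ ≠ 0 ∧
      IsLocalRing.maximalIdeal (RingOfIntegers p L) = Ideal.span {ϖ} := by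
  have hD : IsDedekindDomain (RingOfIntegers p L) := integralClosure.isDedekindDomain ℤ_[p] ℚ_[p] L
  have hloc := isLocalRing_ringOfIntegers p L
  have : CharZero L := Algebra.charZero_of_charZero ℚ_[p] L
  have hp0 : (p : RingOfIntegers p L) ≠ 0 := fun h =>
    (Fact.out : p.Prime).ne_zero (Nat.cast_eq_zero.1
      ((map_natCast (algebraMap (RingOfIntegers p L) L) p).symm.trans
        (congrArg Subtype.val h) : (p : L) = 0))
  have hpm : (p : RingOfIntegers p L) ∈ IsLocalRing.maximalIdeal (RingOfIntegers p L) := by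
    rw [IsLocalRing.mem_maximalIdeal, mem_nonunits_iff, not_isUnit_ringOfIntegers_iff,
      show ((p : RingOfIntegers p L) : L) = algebraMap ℚ_[p] L p from
        (map_natCast (algebraMap (RingOfIntegers p L) L) p).trans (map_natCast _ p).symm,
      spectralNorm_extends]
    exact Padic.norm_p_lt_one
  refine ⟨hD, hp0, hloc, ?_, ?_⟩
  · rw [CharP.charP_iff_prime_eq_zero (Fact.out : p.Prime)]
    rw [← map_natCast (IsLocalRing.residue _), IsLocalRing.residue_eq_zero_iff]
    exact hpm
  · have : IsPrincipalIdealRing (RingOfIntegers p L) := inferInstance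
    obtain ⟨ϖ, hϖ⟩ :=
      (IsPrincipalIdealRing.principal (IsLocalRing.maximalIdeal (RingOfIntegers p L))).principal
    refine ⟨ϖ, ?_, hϖ⟩
    rintro rfl
    rw [hϖ, Ideal.mem_span_singleton, zero_dvd_iff] at hpm
    exact hp0 hpm

theorem det_of_eq_one_off {R ι : Type*} [CommRing R] [Fintype ι] [DecidableEq ι] (z : ι)
    (M : Matrix ι ι R) (hM : ∀ i j, (i, j) ≠ (z, z) → M i j = (1 : Matrix ι ι R) i j) :
    M.det = M z z := by
  have h : M = Matrix.diagonal fun i => M i i := by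
    ext i j
    by_cases hij : i = j
    · rw [hij, Matrix.diagonal_apply_eq]
    · rw [Matrix.diagonal_apply_ne _ hij, hM, Matrix.one_apply_ne hij]
      intro h
      rw [Prod.mk.injEq] at h
      exact hij (h.1.trans h.2.symm)
  rw [h, Matrix.det_diagonal, Finset.prod_eq_single z, Matrix.diagonal_apply_eq]
  · intro i _ hi
    rw [hM, Matrix.one_apply_eq]
    exact fun h => hi (Prod.ext_iff.1 h).1
  · exact fun h => absurd (Finset.mem_univ z) h

theorem mapMatrix_Xt {A A' : Type*} [CommRing A] [CommRing A'] (φ : A →+* A') (N n : ℕ)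
    (i : Fin N) : (MvPowerSeries.map φ).mapMatrix (Xt (A := A) N n i) = Xt N n i := by
  rw [Xt, Xt, map_add, map_one]
  congr 1
  ext1 a b
  exact MvPowerSeries.map_X _ _

theorem map_relMatrix {A A' : Type*} [CommRing A] [CommRing A'] (φ : A →+* A') (q m n : ℕ) :
    (MvPowerSeries.map φ).mapMatrix (relMatrix (A := A) q m n) = relMatrix q m n := by
  refine (map_relWord (MvPowerSeries.map φ) q m (Xt (A := A) (2 * m + 2) n)
    (isUnit_det_Xt _ _)).trans ?_
  change _ = relWord q m (Xt _ n)
  congr 1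
  funext i
  exact mapMatrix_Xt φ _ n i

theorem det_relMatrix {A : Type*} [CommRing A] (q m n : ℕ) :
    (relMatrix (A := A) q m n).det = (Xt (A := A) (2 * m + 2) n ⟨0, by omega⟩).det ^ q :=
  det_relWord q m (Xt (A := A) (2 * m + 2) n) (isUnit_det_Xt _ _)

/-- The ideal of the component of the framed deformation ring on which the determinant of the
first generator equals `ζ`. -/
def detIdeal {A : Type*} [CommRing A] (q m n : ℕ) (ζ : A) :
    Ideal (MvPowerSeries (Fin (2 * m + 2) × Fin n × Fin n) A) :=
  relIdeal q m n ⊔ Ideal.span {(Xt (2 * m + 2) n ⟨0, by omega⟩).det - MvPowerSeries.C ζ}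

theorem ofList_eq_detIdeal {A : Type*} [CommRing A] {q m n : ℕ} {ζ : A} (hζ : ζ ^ q = 1)
    (z : Fin n) (l : List {x : Fin n × Fin n // x ≠ (z, z)}) (hl : ∀ x, x ∈ l) :
    Ideal.ofList (l.map (fun x => (relMatrix (A := A) q m n - 1) x.1.1 x.1.2) ++
      [(Xt (A := A) (2 * m + 2) n ⟨0, by omega⟩).det - MvPowerSeries.C ζ]) =
    detIdeal q m n ζ := by
  set J := Ideal.ofList (l.map (fun x => (relMatrix (A := A) q m n - 1) x.1.1 x.1.2) ++
      [(Xt (A := A) (2 * m + 2) n ⟨0, by omega⟩).det - MvPowerSeries.C ζ]) with hJ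
  have hδ : (Xt (A := A) (2 * m + 2) n ⟨0, by omega⟩).det - MvPowerSeries.C ζ ∈ J :=
    Ideal.subset_span (by simp)
  have hoff : ∀ i j, (i, j) ≠ (z, z) → (relMatrix (A := A) q m n - 1) i j ∈ J := fun i j h =>
    Ideal.subset_span (List.mem_append_left _ (List.mem_map.2 ⟨⟨(i, j), h⟩, hl _, rfl⟩))
  have hz : (relMatrix (A := A) q m n - 1) z z ∈ J := by
    set φ := Ideal.Quotient.mk J
    have h1 := det_of_eq_one_off z (φ.mapMatrix (relMatrix (A := A) q m n)) fun i j h => by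
      have h2 : φ _ = 0 := Ideal.Quotient.eq_zero_iff_mem.2 (hoff i j h)
      rw [Matrix.sub_apply, map_sub, sub_eq_zero] at h2
      refine h2.trans ?_
      rw [Matrix.one_apply, Matrix.one_apply]
      split_ifs <;> simp
    have h3 : φ (Xt (A := A) (2 * m + 2) n ⟨0, by omega⟩).det = φ (MvPowerSeries.C ζ) :=
      Ideal.Quotient.eq.2 hδ
    rw [← RingHom.map_det, det_relMatrix, map_pow, h3, ← map_pow, ← map_pow, hζ, map_one,
      map_one] at h1
    rw [← Ideal.Quotient.eq_zero_iff_mem, Matrix.sub_apply, Matrix.one_apply_eq, map_sub, map_one,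
      sub_eq_zero]
    exact h1.symm
  refine le_antisymm ?_ (sup_le (Ideal.span_le.2 ?_) (Ideal.span_le.2 ?_))
  · refine Ideal.span_le.2 fun f hf => ?_
    rcases List.mem_append.1 hf with hf | hf
    · obtain ⟨x, -, rfl⟩ := List.mem_map.1 hf
      exact Ideal.mem_sup_left (Ideal.subset_span ⟨x.1, rfl⟩)
    · exact Ideal.mem_sup_right (Ideal.subset_span (List.mem_singleton.1 hf))
  · rintro _ ⟨x, rfl⟩
    by_cases hx : x = (z, z)
    · rw [hx]
      exact hz
    · exact hoff x.1 x.2 hx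
  · rintro _ rfl
    exact hδ

theorem detIdeal_isPrime {O : Type*} [CommRing O] [IsDomain O] [IsLocalRing O] [IsNoetherianRing O]
    {p : ℕ} [Fact p.Prime] [CharP (IsLocalRing.ResidueField O) p] {ϖ : O} (h0 : ϖ ≠ 0)
    (hϖ : IsLocalRing.maximalIdeal O = Ideal.span {ϖ}) {s m n : ℕ} (hs : 3 ≤ p ^ s) (hm : 1 ≤ m)
    (hn : 2 ≤ n) (hpn : n < p) {ζ : O} (hζ : ζ ^ p ^ s = 1) :
    (detIdeal (p ^ s) m n ζ).IsPrime ∧ MvPowerSeries.C ϖ ∉ detIdeal (p ^ s) m n ζ := by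
  let z : Fin n := ⟨n - 1, by omega⟩
  obtain ⟨l, hl, hch⟩ := exists_primeChain_relMatrix_of_field (k := IsLocalRing.ResidueField O)
    hs hm hn hpn z rfl
  have hζ1 : IsLocalRing.residue O ζ = 1 := by
    have h := sub_pow_char_pow (R := IsLocalRing.ResidueField O) (p := p) (IsLocalRing.residue O ζ)
      1 s
    rw [← map_pow, hζ, map_one, one_pow, sub_self] at h
    exact sub_eq_zero.1 (pow_eq_zero_iff (by positivity) |>.1 h)
  rw [← ofList_eq_detIdeal hζ z l hl]
  refine (primeChain_of_map_residue ϖ hϖ h0 _ ?_).imp_left PrimeChain.isPrime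
  convert hch using 1
  rw [List.map_append, List.map_map]
  congr 1
  · refine List.map_congr_left fun x _ => ?_
    rw [← map_relMatrix (IsLocalRing.residue O), Function.comp_apply, Matrix.sub_apply,
      Matrix.sub_apply, map_sub]
    congr 1
    rw [Matrix.one_apply, Matrix.one_apply]
    split_ifs <;> simp
  · rw [List.map_singleton, map_sub, RingHom.map_det, mapMatrix_Xt, MvPowerSeries.map_C, hζ1,
      map_one]

theorem detIdeal_isPrime_of_isDedekindDomain {O : Type*} [CommRing O] [IsDedekindDomain O]
    [IsLocalRing O] {p : ℕ} [Fact p.Prime] [CharP (IsLocalRing.ResidueField O) p] {ϖ : O}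
    (h0 : ϖ ≠ 0) (hϖ : IsLocalRing.maximalIdeal O = Ideal.span {ϖ}) {s m n : ℕ} (hs : 3 ≤ p ^ s)
    (hm : 1 ≤ m) (hn : 2 ≤ n) (hpn : n < p) {ζ : O} (hζ : ζ ^ p ^ s = 1) :
    (detIdeal (p ^ s) m n ζ).IsPrime ∧
      ∀ a : O, a ≠ 0 → MvPowerSeries.C a ∉ detIdeal (p ^ s) m n ζ := by
  obtain ⟨hP, hϖP⟩ := detIdeal_isPrime h0 hϖ hs hm hn hpn hζ
  refine ⟨hP, fun a ha haP => hϖP ?_⟩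
  have hc : ((detIdeal (p ^ s) m n ζ).comap MvPowerSeries.C).IsPrime := hP.comap _
  have hne : (detIdeal (p ^ s) m n ζ).comap MvPowerSeries.C ≠ ⊥ := fun h =>
    ha (by simpa [h] using (show a ∈ (detIdeal (p ^ s) m n ζ).comap MvPowerSeries.C from haP))
  have hmax := IsLocalRing.eq_maximalIdeal (hc.isMaximal hne)
  rw [hϖ] at hmax
  change ϖ ∈ (detIdeal (p ^ s) m n ζ).comap MvPowerSeries.C
  rw [hmax]
  exact Ideal.mem_span_singleton_self ϖ

section PairwiseCoprimePrimes

variable {G ι : Type*} [CommRing G] {P : ι → Ideal G}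

theorem eq_of_le_of_pairwise_isCoprime (hco : Pairwise fun i j => IsCoprime (P i) (P j)) {i j : ι}
    {Q : Ideal G} (hQ : Q ≠ ⊤) (hi : P i ≤ Q) (hj : P j ≤ Q) : i = j := by
  by_contra h
  exact hQ (top_le_iff.1 ((Ideal.isCoprime_iff_sup_eq.1 (hco h)).symm.le.trans (sup_le hi hj)))

variable [Finite ι]

theorem bijective_pi_quotient_mk (hco : Pairwise fun i j => IsCoprime (P i) (P j))
    (hbot : ⨅ i, P i = ⊥) :
    Function.Bijective (RingHom.pi fun i => Ideal.Quotient.mk (P i)) := by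
  constructor
  · rw [injective_iff_map_eq_zero]
    intro x hx
    rw [← Ideal.mem_bot, ← hbot, Ideal.mem_iInf]
    exact fun i => Ideal.Quotient.eq_zero_iff_mem.1 (congrFun hx i)
  · intro x
    obtain ⟨r, hr⟩ := Ideal.pi_quotient_surjective hco x
    exact ⟨r, funext hr⟩

theorem exists_le_of_iInf_eq_bot (hbot : ⨅ i, P i = ⊥) (Q : Ideal G) [hQ : Q.IsPrime] :
    ∃ i, P i ≤ Q := by
  cases nonempty_fintype ι
  have h : Finset.univ.inf P ≤ Q := by
    rw [Finset.inf_univ_eq_iInf, hbot]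
    exact bot_le
  obtain ⟨i, -, hi⟩ := hQ.inf_le'.1 h
  exact ⟨i, hi⟩

theorem card_minimalPrimes_of_pairwise_isCoprime
    (hP : ∀ i, (P i).IsPrime) (hco : Pairwise fun i j => IsCoprime (P i) (P j))
    (hbot : ⨅ i, P i = ⊥) :
    Nat.card {Q : Ideal G // Q ∈ minimalPrimes G} = Nat.card ι := by
  have hinj : Function.Injective P := fun i j h =>
    eq_of_le_of_pairwise_isCoprime hco (hP j).ne_top h.le le_rfl
  have hrange : minimalPrimes G = Set.range P := by
    ext Q
    constructor
    · intro hQ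
      have := hQ.1.1
      obtain ⟨i, hi⟩ := exists_le_of_iInf_eq_bot hbot Q
      exact ⟨i, le_antisymm hi (hQ.2 ⟨hP i, bot_le⟩ hi)⟩
    · rintro ⟨i, rfl⟩
      refine ⟨⟨hP i, bot_le⟩, fun Q hQ hle => ?_⟩
      have := hQ.1
      obtain ⟨j, hj⟩ := exists_le_of_iInf_eq_bot hbot Q
      rwa [eq_of_le_of_pairwise_isCoprime hco (hP i).ne_top (hj.trans hle) le_rfl] at hj
  rw [hrange]
  exact Nat.card_range_of_injective hinj

theorem connectedComponent_eq_zeroLocus (hP : ∀ i, (P i).IsPrime)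
    (hco : Pairwise fun i j => IsCoprime (P i) (P j)) (hbot : ⨅ i, P i = ⊥) {i : ι}
    {x : PrimeSpectrum G} (hx : P i ≤ x.asIdeal) :
    connectedComponent x = PrimeSpectrum.zeroLocus (P i) := by
  have hirr : IsIrreducible (PrimeSpectrum.zeroLocus (P i : Set G)) :=
    (PrimeSpectrum.isIrreducible_zeroLocus_iff_of_radical _ (hP i).isRadical).2 (hP i)
  refine subset_antisymm (IsClopen.connectedComponent_subset
    ⟨PrimeSpectrum.isClosed_zeroLocus _, ?_⟩ hx)
    (hirr.isPreirreducible.isPreconnected.subset_connectedComponent hx)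
  have hcompl : PrimeSpectrum.zeroLocus (P i : Set G) =
      (⋃ j : {j // j ≠ i}, PrimeSpectrum.zeroLocus (P j : Set G))ᶜ := by
    ext y
    rw [Set.mem_compl_iff, Set.mem_iUnion]
    constructor
    · rintro hy ⟨j, hj⟩
      exact j.2 (eq_of_le_of_pairwise_isCoprime hco y.2.ne_top hj hy)
    · intro h
      obtain ⟨j, hj⟩ := exists_le_of_iInf_eq_bot hbot y.asIdeal
      by_cases hji : j = i
      · exact hji ▸ hj
      · exact absurd ⟨⟨j, hji⟩, hj⟩ h
  rw [hcompl, isOpen_compl_iff]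
  exact isClosed_iUnion_of_finite fun j => PrimeSpectrum.isClosed_zeroLocus _

theorem isIrreducible_connectedComponent_of_pairwise_isCoprime (hP : ∀ i, (P i).IsPrime)
    (hco : Pairwise fun i j => IsCoprime (P i) (P j)) (hbot : ⨅ i, P i = ⊥)
    (x : PrimeSpectrum G) : IsIrreducible (connectedComponent x) := by
  obtain ⟨i, hi⟩ := exists_le_of_iInf_eq_bot hbot x.asIdeal
  rw [connectedComponent_eq_zeroLocus hP hco hbot hi]
  exact (PrimeSpectrum.isIrreducible_zeroLocus_iff_of_radical _ (hP i).isRadical).2 (hP i)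

theorem card_connectedComponents_of_pairwise_isCoprime (hP : ∀ i, (P i).IsPrime)
    (hco : Pairwise fun i j => IsCoprime (P i) (P j)) (hbot : ⨅ i, P i = ⊥) :
    Nat.card (ConnectedComponents (PrimeSpectrum G)) = Nat.card ι := by
  refine (Nat.card_eq_of_bijective
    (fun i => ((⟨P i, hP i⟩ : PrimeSpectrum G) : ConnectedComponents (PrimeSpectrum G)))
    ⟨fun i j h => ?_, fun c => ?_⟩).symm
  · have h1 : (⟨P j, hP j⟩ : PrimeSpectrum G) ∈ PrimeSpectrum.zeroLocus (P i : Set G) := by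
      rw [← connectedComponent_eq_zeroLocus hP hco hbot (x := ⟨P i, hP i⟩) le_rfl,
        ConnectedComponents.coe_eq_coe.1 h]
      exact mem_connectedComponent
    exact eq_of_le_of_pairwise_isCoprime hco (hP j).ne_top h1 le_rfl
  · obtain ⟨x, rfl⟩ := ConnectedComponents.surjective_coe c
    obtain ⟨i, hi⟩ := exists_le_of_iInf_eq_bot hbot x.asIdeal
    refine ⟨i, ConnectedComponents.coe_eq_coe.2 ?_⟩
    rw [connectedComponent_eq_zeroLocus hP hco hbot hi,
      connectedComponent_eq_zeroLocus hP hco hbot (i := i) le_rfl]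

end PairwiseCoprimePrimes

theorem prod_X_sub_C_eq_X_pow_sub_one {R ι : Type*} [CommRing R] [IsDomain R] [Fintype ι] {q : ℕ}
    (hq : q ≠ 0) {v : ι → R} (hv : Function.Injective v) (hvq : ∀ i, v i ^ q = 1)
    (hcard : Fintype.card ι = q) :
    ∏ i, (Polynomial.X - Polynomial.C (v i)) = Polynomial.X ^ q - 1 := by
  have hX : ((Polynomial.X : Polynomial R) ^ q - 1).degree = q := by
    simpa using Polynomial.degree_X_pow_sub_C (Nat.pos_of_ne_zero hq) (1 : R)
  have hXm : ((Polynomial.X : Polynomial R) ^ q - 1).Monic := by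
    simpa using Polynomial.monic_X_pow_sub_C (1 : R) hq
  have hd : (Lagrange.nodal Finset.univ v).degree = q := by
    rw [Lagrange.degree_nodal, Finset.card_univ, hcard]
  refine Polynomial.eq_of_degree_sub_lt_of_eval_index_eq Finset.univ (hv.injOn) ?_ fun i hi => ?_
  · rw [Finset.card_univ, hcard, ← hd]
    exact Polynomial.degree_sub_lt_left (hd.trans hX.symm) Lagrange.nodal_monic.ne_zero
      (Lagrange.nodal_monic.trans hXm.symm)
  · rw [Polynomial.eval_sub, Polynomial.eval_pow, Polynomial.eval_X, Polynomial.eval_one, hvq,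
      sub_self]
    exact Lagrange.eval_nodal_at_node hi

theorem exists_dvd_pow_of_isDedekindDomain {O : Type*} [CommRing O] [IsDedekindDomain O]
    [IsLocalRing O] {x a : O} (hx : x ∈ IsLocalRing.maximalIdeal O) (ha : a ≠ 0) :
    ∃ k : ℕ, a ∣ x ^ k := by
  have h : x ∈ (Ideal.span {a}).radical := by
    rw [Ideal.radical_eq_sInf, Ideal.mem_sInf]
    rintro Q ⟨hQ, hQp⟩
    have hne : Q ≠ ⊥ := fun h0 =>
      ha (by simpa [h0] using hQ (Ideal.mem_span_singleton_self a))
    rwa [IsLocalRing.eq_maximalIdeal (hQp.isMaximal hne)]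
  obtain ⟨k, hk⟩ := h
  exact ⟨k, Ideal.mem_span_singleton.1 hk⟩

section GenericFiber

variable (p : ℕ) {A : Type*} [CommRing A] (q m n : ℕ)

instance : IsLocalization.Away (p : defRing (A := A) q m n) (genericFiberRing p A q m n) :=
  inferInstanceAs (IsLocalization.Away (p : defRing (A := A) q m n)
    (Localization.Away (p : defRing (A := A) q m n)))

theorem deltaBar_pow : deltaBar p A q m n ^ q = 1 := by
  set φ := Ideal.Quotient.mk (relIdeal (A := A) q m n)
  have h1 : φ.mapMatrix (relMatrix (A := A) q m n) = 1 := by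
    rw [← sub_eq_zero, ← map_one φ.mapMatrix, ← map_sub]
    ext1 i j
    exact Ideal.Quotient.eq_zero_iff_mem.2 (Ideal.subset_span ⟨(i, j), rfl⟩)
  rw [deltaBar, ← map_pow, ← map_pow, ← det_relMatrix, RingHom.map_det, h1, Matrix.det_one, map_one]

theorem componentIdeal_eq_map (ζ : A) : componentIdeal p A q m n ζ =
    ((detIdeal q m n ζ).map (Ideal.Quotient.mk (relIdeal (A := A) q m n))).map
      (algebraMap (defRing (A := A) q m n) (genericFiberRing p A q m n)) := by
  rw [detIdeal, Ideal.map_sup, Ideal.map_quotient_self, bot_sup_eq, Ideal.map_span, Ideal.map_span,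
    Set.image_singleton, Set.image_singleton, map_sub, map_sub]
  rfl

variable {p q m n}

theorem componentIdeal_isPrime {ζ : A} (hP : (detIdeal q m n ζ).IsPrime)
    (hp : MvPowerSeries.C (p : A) ∉ detIdeal q m n ζ) : (componentIdeal p A q m n ζ).IsPrime := by
  have hle : relIdeal (A := A) q m n ≤ detIdeal q m n ζ := le_sup_left
  have hP' : ((detIdeal q m n ζ).map (Ideal.Quotient.mk (relIdeal (A := A) q m n))).IsPrime :=
    Ideal.map_isPrime_of_surjective Ideal.Quotient.mk_surjective (by rwa [Ideal.mk_ker])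
  rw [componentIdeal_eq_map]
  refine IsLocalization.isPrime_of_isPrime_disjoint
    (Submonoid.powers (p : defRing (A := A) q m n)) _ _ hP' ?_
  rw [Set.disjoint_left]
  rintro _ ⟨k, rfl⟩ hk
  have hk' := hP'.mem_of_pow_mem k hk
  rw [← map_natCast (Ideal.Quotient.mk (relIdeal (A := A) q m n)), ← Ideal.mem_comap,
    Ideal.comap_map_mk hle] at hk'
  rw [map_natCast] at hp
  exact hp hk'

theorem isUnit_toGenericFiber {a : A} {k : ℕ} (h : a ∣ (p : A) ^ k) :
    IsUnit (toGenericFiber p A q m n a) := by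
  refine isUnit_of_dvd_unit (map_dvd _ h) ?_
  rw [map_pow, map_natCast, ← map_natCast (algebraMap (defRing (A := A) q m n)
    (genericFiberRing p A q m n))]
  exact (IsLocalization.Away.algebraMap_isUnit _).pow k

theorem isCoprime_componentIdeal {ζ ξ : A} {k : ℕ} (h : ζ - ξ ∣ (p : A) ^ k) :
    IsCoprime (componentIdeal p A q m n ζ) (componentIdeal p A q m n ξ) := by
  rw [componentIdeal, componentIdeal, Ideal.isCoprime_span_singleton_iff]
  obtain ⟨u, hu⟩ := (isUnit_toGenericFiber (q := q) (m := m) (n := n) h).exists_left_inv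
  refine ⟨-u, u, ?_⟩
  rw [map_sub] at hu
  linear_combination hu

theorem iInf_componentIdeal_eq_bot [IsDomain A] {ι : Type*} [Fintype ι] (hq : q ≠ 0) {v : ι → A}
    (hv : Function.Injective v) (hvq : ∀ i, v i ^ q = 1) (hcard : Fintype.card ι = q)
    (hco : Pairwise fun i j =>
      IsCoprime (componentIdeal p A q m n (v i)) (componentIdeal p A q m n (v j))) :
    ⨅ i, componentIdeal p A q m n (v i) = ⊥ := by
  have h : ∏ i, (deltaBar p A q m n - toGenericFiber p A q m n (v i)) = 0 := by
    have h1 := congrArg (Polynomial.eval₂ (toGenericFiber p A q m n) (deltaBar p A q m n))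
      (prod_X_sub_C_eq_X_pow_sub_one hq hv hvq hcard)
    rw [Polynomial.eval₂_finsetProd, Polynomial.eval₂_sub, Polynomial.eval₂_X_pow, deltaBar_pow,
      Polynomial.eval₂_one, sub_self] at h1
    simpa only [Polynomial.eval₂_sub, Polynomial.eval₂_X, Polynomial.eval₂_C] using h1
  refine (Ideal.iInf_span_singleton fun i j hij => ?_).trans ?_
  · exact Ideal.isCoprime_span_singleton_iff _ _ |>.1 (hco hij)
  · rw [h, Ideal.span_singleton_eq_bot]

end GenericFiber

/-- The natural map `R[1/p] → ∏_{ζ ∈ μ_q(L)} R[1/p]/(δ̄ - ζ)` is an isomorphism, each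
factor is a nonzero integral domain; consequently `R[1/p]` has exactly `q` minimal primes
and `Spec R[1/p]` has exactly `q` connected components, all irreducible. -/
theorem generic_fiber_components
    (p s q m n : ℕ) (hs : 1 ≤ s) (hq : q = p ^ s) (hq3 : 3 ≤ q)
    (hm : 1 ≤ m) (hn : 2 ≤ n) (hpn : n < p) [Fact p.Prime]
    (L : Type) [Field L] [Algebra ℚ_[p] L] [FiniteDimensional ℚ_[p] L]
    [Algebra ℤ_[p] L] [IsScalarTower ℤ_[p] ℚ_[p] L]
    (K : Type) [Field K] [Algebra ℚ_[p] K] [FiniteDimensional ℚ_[p] K]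
    (hd : Module.finrank ℚ_[p] K = 2 * m)
    (hK : Nat.card {ζ : K // ∃ t : ℕ, ζ ^ p ^ t = 1} = q)
    (hμL : Nat.card {ζ : L // ζ ^ q = 1} = q) :
    Function.Bijective
      (Pi.ringHom fun ζ : {z : L // z ^ q = 1} =>
        Ideal.Quotient.mk
          (componentIdeal p (RingOfIntegers p L) q m n
            (rootOfUnityToO p L q (by omega) ζ))) ∧
    (∀ ζ : {z : L // z ^ q = 1},
      IsDomain (genericFiberRing p (RingOfIntegers p L) q m n ⧸
        componentIdeal p (RingOfIntegers p L) q m n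
          (rootOfUnityToO p L q (by omega) ζ))) ∧
    Nat.card {P : Ideal (genericFiberRing p (RingOfIntegers p L) q m n) //
      P ∈ minimalPrimes (genericFiberRing p (RingOfIntegers p L) q m n)} = q ∧
    Nat.card
      (ConnectedComponents (PrimeSpectrum (genericFiberRing p (RingOfIntegers p L) q m n)))
        = q ∧
    (∀ x : PrimeSpectrum (genericFiberRing p (RingOfIntegers p L) q m n),
      IsIrreducible (connectedComponent x)) := by
  obtain ⟨hD, hp0, hloc, hchar, ϖ, hϖ0, hϖ⟩ := exists_uniformizer_ringOfIntegers p L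
  have hq0 : q ≠ 0 := by omega
  have hfin : Finite {ζ : L // ζ ^ q = 1} := Nat.finite_of_card_ne_zero (hμL.trans_ne hq0)
  cases nonempty_fintype {ζ : L // ζ ^ q = 1}
  let v : {ζ : L // ζ ^ q = 1} → RingOfIntegers p L := rootOfUnityToO p L q hq0
  have hv : Function.Injective v := fun ζ ξ h => 
    Subtype.ext (congrArg (fun x : RingOfIntegers p L => (x : L)) h)
  have hvq : ∀ ζ, v ζ ^ q = 1 := fun ζ => Subtype.ext ζ.2
  have hpm : (p : RingOfIntegers p L) ∈ IsLocalRing.maximalIdeal (RingOfIntegers p L) := by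
    rw [← IsLocalRing.residue_eq_zero_iff, map_natCast]
    exact CharP.cast_eq_zero _ p
  have hP : ∀ ζ, (componentIdeal p (RingOfIntegers p L) q m n (v ζ)).IsPrime := by
    intro ζ
    have hvζ := hvq ζ
    subst hq
    obtain ⟨h1, h2⟩ := detIdeal_isPrime_of_isDedekindDomain hϖ0 hϖ hq3 hm hn hpn hvζ
    exact componentIdeal_isPrime h1 (h2 _ hp0)
  have hco : Pairwise fun ζ ξ => IsCoprime (componentIdeal p (RingOfIntegers p L) q m n (v ζ))
      (componentIdeal p (RingOfIntegers p L) q m n (v ξ)) := by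
    intro ζ ξ h
    obtain ⟨k, hk⟩ := exists_dvd_pow_of_isDedekindDomain hpm (sub_ne_zero.2 (hv.ne h))
    exact isCoprime_componentIdeal hk
  have hbot := iInf_componentIdeal_eq_bot hq0 hv hvq
    (Nat.card_eq_fintype_card.symm.trans hμL) hco
  refine ⟨bijective_pi_quotient_mk hco hbot, fun ζ => ?_,
    (card_minimalPrimes_of_pairwise_isCoprime hP hco hbot).trans hμL,
    (card_connectedComponents_of_pairwise_isCoprime hP hco hbot).trans hμL,
    isIrreducible_connectedComponent_of_pairwise_isCoprime hP hco hbot⟩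
  have := hP ζ
  exact Ideal.Quotient.isDomain _
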